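/- arXiv:2506.17704 — 4 statements merged into one kernel-verified Lean document; each statement's English description precedes it below -/
import Mathlib

section
/- Let R = ℂ[x,y,z] and let I ⊆ R be a Borel-fixed monomial ideal of colength l = dim_ℂ(R/I) with x ∈ I (i.e., the smallest pure power of x lying in I is x itself). Then dim_ℂ Hom_R(I, R/I) = 3l. In particular, T_{max,1}(l) = 3l for every l ≥ 1. -/
open MvPolynomial

/-- A monomial ideal: an ideal containing the monomials of all its elements. -/
def IsMonomialIdeal (I : Ideal (MvPolynomial (Fin 3) ℂ)) : Prop :=
  ∀ p ∈ I, ∀ d ∈ p.support, (monomial d (1 : ℂ)) ∈ I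

/-- Borel-fixed (strongly stable) in characteristic 0: for every monomial in `I`
divisible by `x_j`, and every `i < j`, replacing one factor `x_j` by `x_i`
stays in `I`. -/
def IsBorelFixed (I : Ideal (MvPolynomial (Fin 3) ℂ)) : Prop :=
  ∀ d : Fin 3 →₀ ℕ, (monomial d (1 : ℂ)) ∈ I →
    ∀ i j : Fin 3, i < j → 0 < d j →
      (monomial (d + Finsupp.single i 1 - Finsupp.single j 1) (1 : ℂ)) ∈ I

/-- The dimension of the tangent space to the Hilbert scheme at `[I]`,
namely `dim_ℂ Hom_R(I, R/I)`. -/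
noncomputable def tangentDim (I : Ideal (MvPolynomial (Fin 3) ℂ)) : ℕ :=
  Module.finrank ℂ (↥I →ₗ[MvPolynomial (Fin 3) ℂ] (MvPolynomial (Fin 3) ℂ ⧸ I))

/-- `TmaxEq l m1 T` says that `T` is the maximum of `dim_ℂ Hom_R(I, R/I)` over all
Borel-fixed monomial ideals `I ⊆ ℂ[x,y,z]` of colength `l` whose smallest pure power
of `x` lying in `I` is `x^{m1}`. -/
def TmaxEq (l m1 T : ℕ) : Prop :=
  IsGreatest { t : ℕ | ∃ I : Ideal (MvPolynomial (Fin 3) ℂ),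
      IsMonomialIdeal I ∧ IsBorelFixed I ∧
      Module.finrank ℂ (MvPolynomial (Fin 3) ℂ ⧸ I) = l ∧
      (X 0 : MvPolynomial (Fin 3) ℂ) ^ m1 ∈ I ∧
      (X 0 : MvPolynomial (Fin 3) ℂ) ^ (m1 - 1) ∉ I ∧
      t = tangentDim I } T

namespace BorelTangent

/-- The polynomial ring `ℂ[x, y, z]`. -/
abbrev Poly : Type := MvPolynomial (Fin 3) ℂ

/-- The monomial `x ^ a * y ^ i * z ^ j`. -/
noncomputable def mon (a i j : ℕ) : Poly := X 0 ^ a * X 1 ^ i * X 2 ^ j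

lemma monomial_eq_mon (d : Fin 3 →₀ ℕ) : monomial d (1 : ℂ) = mon (d 0) (d 1) (d 2) := by
  rw [monomial_eq, Finsupp.prod_fintype _ _ (by simp), Fin.prod_univ_three]
  simp [mon]

lemma X_zero_mul_mon (a i j : ℕ) : X 0 * mon a i j = mon (a + 1) i j := by
  simp only [mon]; ring

lemma X_one_mul_mon (a i j : ℕ) : X 1 * mon a i j = mon a (i + 1) j := by
  simp only [mon]; ring

lemma X_two_pow_mul_mon (a i j k : ℕ) : X 2 ^ k * mon a i j = mon a i (j + k) := by
  simp only [mon]; ring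

lemma X_two_mul_mon (a i j : ℕ) : X 2 * mon a i j = mon a i (j + 1) := by
  simp only [mon]; ring

section Lift

variable {V : Type*} [AddCommGroup V] [Module ℂ V]

/-- The linear map on `ℂ[x, y, z]` with prescribed values on monomials. -/
noncomputable def monLift (v : ℕ → ℕ → ℕ → V) : Poly →ₗ[ℂ] V :=
  (basisMonomials (Fin 3) ℂ).constr ℂ fun d => v (d 0) (d 1) (d 2)

lemma monLift_monomial (v : ℕ → ℕ → ℕ → V) (d : Fin 3 →₀ ℕ) :
    monLift v (monomial d 1) = v (d 0) (d 1) (d 2) := by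
  have h := (basisMonomials (Fin 3) ℂ).constr_basis ℂ (fun d => v (d 0) (d 1) (d 2)) d
  rwa [coe_basisMonomials] at h

lemma exists_exponent (a i j : ℕ) : ∃ d : Fin 3 →₀ ℕ, d 0 = a ∧ d 1 = i ∧ d 2 = j :=
  ⟨Finsupp.equivFunOnFinite.symm ![a, i, j], by simp⟩

@[simp]
lemma monLift_mon (v : ℕ → ℕ → ℕ → V) (a i j : ℕ) : monLift v (mon a i j) = v a i j := by
  obtain ⟨d, rfl, rfl, rfl⟩ := exists_exponent a i j
  rw [← monomial_eq_mon, monLift_monomial]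

lemma hom_ext_mon {f g : Poly →ₗ[ℂ] V} (h : ∀ a i j, f (mon a i j) = g (mon a i j)) : f = g := by
  refine (basisMonomials (Fin 3) ℂ).ext fun d => ?_
  rw [coe_basisMonomials]
  change f (monomial d 1) = g (monomial d 1)
  rw [monomial_eq_mon, h]

end Lift

lemma mem_of_support {I : Ideal Poly} {p : Poly}
    (h : ∀ d ∈ p.support, monomial d (1 : ℂ) ∈ I) : p ∈ I := by
  rw [p.as_sum]
  refine I.sum_mem fun d hd => ?_
  have := I.mul_mem_left (C (p.coeff d)) (h d hd)
  rwa [C_mul_monomial, mul_one] at this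

/-- `I` is the monomial ideal containing `x` whose section `x = 0` is the staircase with column
heights `b`. -/
structure IsStaircase (I : Ideal Poly) (b : ℕ → ℕ) (n : ℕ) : Prop where
  isMonomial : IsMonomialIdeal I
  mon_mem_iff : ∀ a i j, mon a i j ∈ I ↔ 0 < a ∨ b i ≤ j
  eq_zero : b n = 0

lemma exists_pow_mem {I : Ideal Poly} (hI : IsMonomialIdeal I)
    [FiniteDimensional ℂ (Poly ⧸ I)] (k : Fin 3) : ∃ n, (X k : Poly) ^ n ∈ I := by
  obtain ⟨q, hq, h⟩ := Algebra.IsIntegral.isIntegral (R := ℂ) (Ideal.Quotient.mk I (X k))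
  have h' : Polynomial.aeval (X k : Poly) q ∈ I := by
    rw [← Ideal.Quotient.eq_zero_iff_mem, ← h]
    rw [← Ideal.Quotient.mkₐ_eq_mk ℂ, ← Polynomial.aeval_algHom_apply, Polynomial.aeval_def]
  refine ⟨q.natDegree, ?_⟩
  have := hI _ h' (Finsupp.single k q.natDegree) ?_
  · rwa [← X_pow_eq_monomial] at this
  · rw [mem_support_iff, Polynomial.aeval_eq_sum_range, coeff_sum]
    rw [Finset.sum_eq_single q.natDegree]
    · simp [hq, coeff_X_pow]
    · intro m _ hm
      rw [coeff_smul, coeff_X_pow, if_neg, smul_zero]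
      intro h
      exact hm (Finsupp.single_injective k h)
    · simp

lemma exists_isStaircase {I : Ideal Poly} (hI : IsMonomialIdeal I)
    [FiniteDimensional ℂ (Poly ⧸ I)] (hx : (X 0 : Poly) ∈ I) : ∃ b n, IsStaircase I b n := by
  obtain ⟨n, hn⟩ := exists_pow_mem hI 1
  obtain ⟨N, hN⟩ := exists_pow_mem hI 2
  have hex : ∀ i, ∃ j, mon 0 i j ∈ I := fun i => ⟨N, I.mul_mem_left _ hN⟩
  classical
  refine ⟨fun i => Nat.find (hex i), n, hI, fun a i j => ?_, ?_⟩
  · rcases a with _ | a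
    · simp only [lt_irrefl, false_or]
      refine ⟨fun h => Nat.find_min' _ h, fun h => ?_⟩
      obtain ⟨k, rfl⟩ := Nat.exists_eq_add_of_le h
      rw [← X_two_pow_mul_mon]
      exact I.mul_mem_left _ (Nat.find_spec (hex i))
    · simp only [Nat.succ_pos, true_or, iff_true]
      rw [← X_zero_mul_mon]
      exact I.mul_mem_right _ hx
  · simpa [mon] using hn

namespace IsStaircase

variable {I : Ideal Poly} {b : ℕ → ℕ} {n : ℕ}

lemma succ_le (h : IsStaircase I b n) (k : ℕ) : b (k + 1) ≤ b k := by
  have h1 : mon 0 k (b k) ∈ I := (h.mon_mem_iff _ _ _).2 (Or.inr le_rfl)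
  have h2 := I.mul_mem_left (X 1) h1
  rw [X_one_mul_mon, h.mon_mem_iff] at h2
  simpa using h2

lemma eq_zero_of_le (h : IsStaircase I b n) {k : ℕ} (hk : n ≤ k) : b k = 0 := by
  have := antitone_nat_of_succ_le h.succ_le hk
  have := h.eq_zero
  omega

lemma X_zero_mem (h : IsStaircase I b n) : (X 0 : Poly) ∈ I := by
  simpa [mon] using (h.mon_mem_iff 1 0 0).2 (Or.inl one_pos)

lemma X_zero_smul (h : IsStaircase I b n) (m : Poly ⧸ I) : (X 0 : Poly) • m = 0 := by
  obtain ⟨p, rfl⟩ := I.mkQ_surjective m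
  rw [← map_smul, Submodule.mkQ_apply, Submodule.Quotient.mk_eq_zero]
  exact I.mul_mem_right _ h.X_zero_mem

lemma smul_eq_zero_of_mem {p : Poly} (hp : p ∈ I) (m : Poly ⧸ I) : p • m = 0 := by
  obtain ⟨q, rfl⟩ := I.mkQ_surjective m
  rw [← map_smul, Submodule.mkQ_apply, Submodule.Quotient.mk_eq_zero]
  exact I.mul_mem_right _ hp

lemma le_ker (h : IsStaircase I b n) {V : Type*} [AddCommGroup V] [Module ℂ V]
    (f : Poly →ₗ[ℂ] V) (hf : ∀ a i j, 0 < a ∨ b i ≤ j → f (mon a i j) = 0) :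
    I.restrictScalars ℂ ≤ LinearMap.ker f := by
  intro p hp
  rw [LinearMap.mem_ker, p.as_sum, map_sum]
  refine Finset.sum_eq_zero fun d hd => ?_
  have h1 := h.isMonomial p hp d hd
  rw [monomial_eq_mon, h.mon_mem_iff] at h1
  rw [← mul_one (coeff d p), ← smul_eq_mul, ← smul_monomial, map_smul, monomial_eq_mon,
    hf _ _ _ h1, smul_zero]

/-- Linear maps on `R ⧸ I` with prescribed values on the monomials, provided these vanish on the
monomials of `I`. -/
lemma exists_lift (h : IsStaircase I b n) {V : Type*} [AddCommGroup V] [Module ℂ V]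
    (v : ℕ → ℕ → ℕ → V) (hv : ∀ a i j, 0 < a ∨ b i ≤ j → v a i j = 0) :
    ∃ f : (Poly ⧸ I) →ₗ[ℂ] V, ∀ a i j, f (I.mkQ (mon a i j)) = v a i j := by
  refine ⟨((I.restrictScalars ℂ).liftQ (monLift v) (h.le_ker _ fun a i j hh => ?_)) ∘ₗ
    (Submodule.Quotient.restrictScalarsEquiv ℂ I).symm.toLinearMap, fun a i j => ?_⟩
  · rw [monLift_mon, hv _ _ _ hh]
  · have : (Submodule.Quotient.restrictScalarsEquiv ℂ I).symm (I.mkQ (mon a i j)) =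
      (I.restrictScalars ℂ).mkQ (mon a i j) := rfl
    rw [LinearMap.comp_apply, LinearEquiv.coe_coe, this, Submodule.mkQ_apply,
      Submodule.liftQ_apply, monLift_mon]

lemma quotient_hom_ext {V : Type*} [AddCommGroup V] [Module ℂ V]
    {f g : (Poly ⧸ I) →ₗ[ℂ] V} (h : ∀ a i j, f (I.mkQ (mon a i j)) = g (I.mkQ (mon a i j))) :
    f = g := by
  have : f ∘ₗ (I.mkQ.restrictScalars ℂ) = g ∘ₗ (I.mkQ.restrictScalars ℂ) := hom_ext_mon h
  ext m
  obtain ⟨p, rfl⟩ := I.mkQ_surjective m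
  exact LinearMap.congr_fun this p

/-- Multiplication by a polynomial, as a `ℂ`-linear endomorphism of `R ⧸ I`. -/
noncomputable abbrev mulBy (I : Ideal Poly) (p : Poly) : (Poly ⧸ I) →ₗ[ℂ] (Poly ⧸ I) :=
  (LinearMap.lsmul Poly (Poly ⧸ I) p).restrictScalars ℂ

lemma exists_socle_functional (h : IsStaircase I b n) (k : ℕ) :
    ∃ f : (Poly ⧸ I) →ₗ[ℂ] ℂ, ∀ a i j,
      f (I.mkQ (mon a i j)) = if a = 0 ∧ i = k ∧ j + 1 = b k then 1 else 0 := by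
  refine h.exists_lift _ fun a i j hh => if_neg ?_
  rintro ⟨rfl, rfl, h3⟩
  omega

/-- The functional on `R ⧸ I` reading off the coefficient of the top monomial
`y ^ k * z ^ (b k - 1)` of the `k`-th column. -/
noncomputable def socle (h : IsStaircase I b n) (k : ℕ) : (Poly ⧸ I) →ₗ[ℂ] ℂ :=
  (h.exists_socle_functional k).choose

lemma socle_mon (h : IsStaircase I b n) (k a i j : ℕ) :
    h.socle k (I.mkQ (mon a i j)) = if a = 0 ∧ i = k ∧ j + 1 = b k then 1 else 0 :=
  (h.exists_socle_functional k).choose_spec a i j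

lemma socle_zero_smul (h : IsStaircase I b n) (m : Poly ⧸ I) :
    h.socle 0 ((X 1 : Poly) • m) = 0 := by
  have : h.socle 0 ∘ₗ mulBy I (X 1) = 0 := by
    refine quotient_hom_ext fun a i j => ?_
    change h.socle 0 ((X 1 : Poly) • I.mkQ (mon a i j)) = 0
    rw [← map_smul, smul_eq_mul, X_one_mul_mon, socle_mon, if_neg (by omega)]
  exact LinearMap.congr_fun this m

lemma socle_succ_smul (h : IsStaircase I b n) (k : ℕ) (m : Poly ⧸ I) :
    h.socle (k + 1) ((X 1 : Poly) • m) =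
      h.socle k ((X 2 ^ (b k - b (k + 1)) : Poly) • m) := by
  have : h.socle (k + 1) ∘ₗ mulBy I (X 1) =
      h.socle k ∘ₗ mulBy I (X 2 ^ (b k - b (k + 1))) := by
    refine quotient_hom_ext fun a i j => ?_
    change h.socle (k + 1) ((X 1 : Poly) • I.mkQ (mon a i j)) =
      h.socle k ((X 2 ^ (b k - b (k + 1)) : Poly) • I.mkQ (mon a i j))
    rw [← map_smul, ← map_smul, smul_eq_mul, smul_eq_mul, X_one_mul_mon, X_two_pow_mul_mon,
      socle_mon, socle_mon]
    have := h.succ_le k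
    congr 1
    apply propext
    constructor <;> rintro ⟨h1, h2, h3⟩ <;> refine ⟨h1, ?_, ?_⟩ <;> omega
  exact LinearMap.congr_fun this m

lemma socle_of_le (h : IsStaircase I b n) {k : ℕ} (hk : n ≤ k) : h.socle k = 0 := by
  refine quotient_hom_ext fun a i j => ?_
  have := h.eq_zero_of_le hk
  rw [socle_mon, if_neg (by omega), LinearMap.zero_apply]

lemma eq_zero_of_socle (h : IsStaircase I b n) (m : Poly ⧸ I)
    (hm : ∀ k < n, ∀ p : Poly, h.socle k (p • m) = 0) : m = 0 := by
  obtain ⟨p, rfl⟩ := I.mkQ_surjective m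
  rw [Submodule.mkQ_apply, Submodule.Quotient.mk_eq_zero]
  refine mem_of_support fun d hd => ?_
  by_contra hdI
  rw [monomial_eq_mon, h.mon_mem_iff] at hdI
  push Not at hdI
  have hlt : d 1 < n := by
    by_contra hle
    have := h.eq_zero_of_le (not_lt.1 hle)
    omega
  have key : h.socle (d 1) ∘ₗ mulBy I (X 2 ^ (b (d 1) - 1 - d 2)) ∘ₗ I.mkQ.restrictScalars ℂ =
      lcoeff ℂ d := by
    refine (basisMonomials (Fin 3) ℂ).ext fun e => ?_
    rw [coe_basisMonomials]
    change h.socle (d 1) ((X 2 ^ (b (d 1) - 1 - d 2) : Poly) • I.mkQ (monomial e 1)) =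
      coeff d (monomial e 1)
    rw [← map_smul, smul_eq_mul, monomial_eq_mon, X_two_pow_mul_mon, socle_mon,
      ← monomial_eq_mon, coeff_monomial]
    congr 1
    apply propext
    constructor
    · rintro ⟨h1, h2, h3⟩
      ext t
      fin_cases t
      · change e 0 = d 0; omega
      · exact h2
      · change e 2 = d 2; omega
    · rintro rfl
      refine ⟨?_, rfl, ?_⟩ <;> omega
  have := LinearMap.congr_fun key p
  rw [mem_support_iff] at hd
  exact hd (this.symm.trans (hm _ hlt _))

/-- The syzygy map `(f_k) ↦ (y f_k - z ^ (b k - b (k + 1)) f_{k + 1})`. -/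
noncomputable def syzygyMap (I : Ideal Poly) (b : ℕ → ℕ) (n : ℕ) :
    (Fin (n + 1) → Poly ⧸ I) →ₗ[ℂ] (Fin n → Poly ⧸ I) :=
  LinearMap.pi fun k =>
    mulBy I (X 1) ∘ₗ LinearMap.proj k.castSucc -
      mulBy I (X 2 ^ (b k - b (k + 1))) ∘ₗ LinearMap.proj k.succ

lemma syzygyMap_apply (f : Fin (n + 1) → Poly ⧸ I) (k : Fin n) :
    syzygyMap I b n f k =
      (X 1 : Poly) • f k.castSucc - (X 2 ^ (b k - b (k + 1)) : Poly) • f k.succ := rfl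

/-- The pairing of `R ⧸ I` with `(R ⧸ I) ^ n` that vanishes on the image of the syzygy map. -/
noncomputable def pairing (h : IsStaircase I b n) :
    (Poly ⧸ I) →ₗ[ℂ] Module.Dual ℂ (Fin n → Poly ⧸ I) :=
  ∑ k : Fin n, ((LinearMap.mul ℂ (Poly ⧸ I)).compr₂ (h.socle k)).compl₂ (LinearMap.proj k)

lemma pairing_apply (h : IsStaircase I b n) (m : Poly ⧸ I) (g : Fin n → Poly ⧸ I) :
    h.pairing m g = ∑ k : Fin n, h.socle k (m * g k) := by
  simp [pairing]

lemma pairing_injective (h : IsStaircase I b n) : Function.Injective h.pairing := by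
  rw [← LinearMap.ker_eq_bot, LinearMap.ker_eq_bot']
  intro m hm
  refine h.eq_zero_of_socle m fun k hk p => ?_
  have := LinearMap.congr_fun hm (Pi.single ⟨k, hk⟩ (I.mkQ p))
  rw [pairing_apply, Finset.sum_eq_single ⟨k, hk⟩] at this
  · rw [Pi.single_eq_same] at this
    rw [show p • m = m * I.mkQ p by rw [mul_comm]; rfl]
    exact this
  · intro j _ hj
    rw [Pi.single_eq_of_ne hj, mul_zero, map_zero]
  · simp

lemma pairing_syzygyMap (h : IsStaircase I b n) (m : Poly ⧸ I) (f : Fin (n + 1) → Poly ⧸ I) :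
    h.pairing m (syzygyMap I b n f) = 0 := by
  rw [pairing_apply]
  let G : Fin (n + 1) → ℂ := fun k => h.socle k ((X 1 : Poly) • (m * f k))
  have h1 : ∀ k : Fin n, h.socle k (m * syzygyMap I b n f k) = G k.castSucc - G k.succ := by
    intro k
    simp only [G]
    rw [syzygyMap_apply, mul_sub, map_sub, mul_smul_comm, mul_smul_comm, Fin.val_succ,
      socle_succ_smul, Fin.val_castSucc]
  rw [Finset.sum_congr rfl fun k _ => h1 k, Finset.sum_sub_distrib]
  have h2 := Fin.sum_univ_castSucc G
  have h3 := Fin.sum_univ_succ G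
  have h4 : G 0 = 0 := h.socle_zero_smul _
  have h5 : G (Fin.last n) = 0 := by
    simp only [G, Fin.val_last]
    rw [h.socle_of_le le_rfl, LinearMap.zero_apply]
  rw [h4, zero_add] at h3
  rw [h5, add_zero] at h2
  rw [← h2, ← h3, sub_self]

lemma finrank_le_coker (h : IsStaircase I b n) [FiniteDimensional ℂ (Poly ⧸ I)] :
    Module.finrank ℂ (Poly ⧸ I) ≤
      Module.finrank ℂ ((Fin n → Poly ⧸ I) ⧸ LinearMap.range (syzygyMap I b n)) := by
  have h1 : ∀ m, h.pairing m ∈ (LinearMap.range (syzygyMap I b n)).dualAnnihilator := by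
    intro m
    rw [Submodule.mem_dualAnnihilator]
    rintro _ ⟨f, rfl⟩
    exact h.pairing_syzygyMap m f
  have h2 := LinearMap.finrank_le_finrank_of_injective
    (f := h.pairing.codRestrict _ h1) fun x y hxy => h.pairing_injective (congrArg Subtype.val hxy)
  have h3 := Subspace.finrank_add_finrank_dualAnnihilator_eq (LinearMap.range (syzygyMap I b n))
  have h4 := Submodule.finrank_quotient_add_finrank (LinearMap.range (syzygyMap I b n))
  omega

/-- The map placing an element of `R ⧸ I` in the `k`-th coordinate of the cokernel of the
syzygy map. -/
noncomputable def cokerSingle (I : Ideal Poly) (b : ℕ → ℕ) (n k : ℕ) :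
    (Poly ⧸ I) →ₗ[ℂ] ((Fin n → Poly ⧸ I) ⧸ LinearMap.range (syzygyMap I b n)) :=
  if hk : k < n then
    (LinearMap.range (syzygyMap I b n)).mkQ ∘ₗ LinearMap.single ℂ (fun _ => Poly ⧸ I) ⟨k, hk⟩
  else 0

lemma cokerSingle_of_lt {k : ℕ} (hk : k < n) (m : Poly ⧸ I) : cokerSingle I b n k m =
    (LinearMap.range (syzygyMap I b n)).mkQ (Pi.single ⟨k, hk⟩ m) := by
  simp [cokerSingle, hk]

lemma cokerSingle_of_le {k : ℕ} (hk : n ≤ k) : cokerSingle I b n k = 0 := by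
  simp [cokerSingle, hk]

lemma cokerSingle_zero_smul (m : Poly ⧸ I) : cokerSingle I b n 0 ((X 1 : Poly) • m) = 0 := by
  rcases Nat.eq_zero_or_pos n with rfl | hn
  · rw [cokerSingle_of_le le_rfl, LinearMap.zero_apply]
  rw [cokerSingle_of_lt hn, Submodule.mkQ_apply, Submodule.Quotient.mk_eq_zero]
  refine ⟨Pi.single 0 m, ?_⟩
  ext k : 1
  rw [syzygyMap_apply, Pi.single_eq_of_ne (Fin.succ_ne_zero k), smul_zero, sub_zero]
  by_cases hk : k = ⟨0, hn⟩
  · subst hk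
    rw [Pi.single_eq_same]
    congr 1
  · rw [Pi.single_eq_of_ne hk, Pi.single_eq_of_ne, smul_zero]
    intro h0
    apply hk
    ext
    simpa using congrArg Fin.val h0

lemma cokerSingle_succ_smul (k : ℕ) (m : Poly ⧸ I) :
    cokerSingle I b n (k + 1) ((X 1 : Poly) • m) =
      cokerSingle I b n k ((X 2 ^ (b k - b (k + 1)) : Poly) • m) := by
  rcases le_or_gt n k with hk | hk
  · rw [cokerSingle_of_le hk, cokerSingle_of_le (by omega)]
    rfl
  rw [cokerSingle_of_lt hk, ← sub_eq_zero]
  have h1 : (LinearMap.range (syzygyMap I b n)).mkQ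
      (syzygyMap I b n (Pi.single ⟨k + 1, by omega⟩ m)) = 0 := by
    rw [Submodule.mkQ_apply, Submodule.Quotient.mk_eq_zero]
    exact ⟨_, rfl⟩
  rw [← h1]
  have h2 : cokerSingle I b n (k + 1) ((X 1 : Poly) • m) =
      (LinearMap.range (syzygyMap I b n)).mkQ
        (fun j : Fin n => if (j : ℕ) = k + 1 then (X 1 : Poly) • m else 0) := by
    rcases le_or_gt n (k + 1) with hk' | hk'
    · rw [cokerSingle_of_le hk', LinearMap.zero_apply]
      have h3 : (fun j : Fin n => if (j : ℕ) = k + 1 then (X 1 : Poly) • m else 0) = 0 := by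
        ext j : 1
        rw [if_neg (by omega), Pi.zero_apply]
      rw [h3, map_zero]
    · rw [cokerSingle_of_lt hk']
      congr 1
      ext j : 1
      simp [Pi.single_apply, Fin.ext_iff]
  rw [h2, ← map_sub]
  congr 1
  ext j : 1
  rw [syzygyMap_apply, Pi.sub_apply]
  simp only [Pi.single_apply, Fin.ext_iff, Fin.val_castSucc, Fin.val_succ, Nat.add_right_cancel_iff,
    smul_ite, smul_zero]
  congr 1
  split_ifs with hj
  · rw [hj]
  · rfl

lemma cokerSingle_pow_smul (h : IsStaircase I b n) (d : ℕ) :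
    ∀ k, n ≤ k + d → ∀ m : Poly ⧸ I, cokerSingle I b n k ((X 2 ^ b k : Poly) • m) = 0 := by
  induction d with
  | zero =>
    intro k hk m
    rw [cokerSingle_of_le (by omega), LinearMap.zero_apply]
  | succ d ih =>
    intro k hk m
    have := h.succ_le k
    rw [show b k = (b k - b (k + 1)) + b (k + 1) by omega, pow_add, mul_smul,
      ← cokerSingle_succ_smul, smul_comm]
    exact ih _ (by omega) _

lemma coker_le_finrank (h : IsStaircase I b n) [FiniteDimensional ℂ (Poly ⧸ I)] :
    Module.finrank ℂ ((Fin n → Poly ⧸ I) ⧸ LinearMap.range (syzygyMap I b n)) ≤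
      Module.finrank ℂ (Poly ⧸ I) := by
  obtain ⟨s, hs⟩ := h.exists_lift
    (fun a i j => if a = 0 then cokerSingle I b n i (I.mkQ (mon 0 0 j)) else 0) (by
      intro a i j hh
      rcases Nat.eq_zero_or_pos a with rfl | ha
      · obtain ⟨c, rfl⟩ := Nat.exists_eq_add_of_le (hh.resolve_left (lt_irrefl 0))
        rw [if_pos rfl, Nat.add_comm (b i) c, ← X_two_pow_mul_mon, ← smul_eq_mul, map_smul]
        exact h.cokerSingle_pow_smul n i (by omega) _
      · rw [if_neg (by omega)])
  refine LinearMap.finrank_le_finrank_of_surjective (f := s) ?_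
  rw [← LinearMap.range_eq_top]
  have h1 : ∀ i k j, cokerSingle I b n k (I.mkQ (mon 0 i j)) ∈ LinearMap.range s := by
    intro i
    induction i with
    | zero => exact fun k j => ⟨I.mkQ (mon 0 k j), by rw [hs, if_pos rfl]⟩
    | succ i ih =>
      intro k j
      rw [← X_one_mul_mon, ← smul_eq_mul, map_smul]
      rcases k with _ | k
      · rw [cokerSingle_zero_smul]
        exact zero_mem _
      · rw [cokerSingle_succ_smul, ← map_smul, smul_eq_mul, X_two_pow_mul_mon]
        exact ih _ _
  have h2 : ∀ k m, cokerSingle I b n k m ∈ LinearMap.range s := by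
    intro k m
    have : (LinearMap.range s).mkQ ∘ₗ cokerSingle I b n k = 0 := by
      refine quotient_hom_ext fun a i j => ?_
      rw [LinearMap.comp_apply, LinearMap.zero_apply, Submodule.mkQ_apply,
        Submodule.Quotient.mk_eq_zero]
      rcases a with _ | a
      · exact h1 _ _ _
      · rw [← X_zero_mul_mon, ← smul_eq_mul, map_smul, h.X_zero_smul, map_zero]
        exact zero_mem _
    have := LinearMap.congr_fun this m
    rwa [LinearMap.comp_apply, LinearMap.zero_apply, Submodule.mkQ_apply,
        Submodule.Quotient.mk_eq_zero] at this
  rw [eq_top_iff]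
  rintro q -
  obtain ⟨g, rfl⟩ := Submodule.mkQ_surjective _ q
  rw [← Finset.univ_sum_single g, map_sum]
  refine Submodule.sum_mem _ fun k _ => ?_
  have := h2 k (g k)
  rwa [cokerSingle_of_lt k.2] at this

lemma finrank_ker_syzygyMap (h : IsStaircase I b n) [FiniteDimensional ℂ (Poly ⧸ I)] :
    Module.finrank ℂ (LinearMap.ker (syzygyMap I b n)) = 2 * Module.finrank ℂ (Poly ⧸ I) := by
  have h1 := h.finrank_le_coker
  have h2 := h.coker_le_finrank
  have h3 := Submodule.finrank_quotient_add_finrank (LinearMap.range (syzygyMap I b n))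
  have h4 := LinearMap.finrank_range_add_finrank_ker (syzygyMap I b n)
  rw [Module.finrank_pi_fintype] at h3 h4
  simp only [Finset.sum_const, Finset.card_univ, Fintype.card_fin, smul_eq_mul, add_mul, one_mul]
    at h3 h4
  omega

/-- The generator `y ^ k * z ^ b k` of `I`. -/
noncomputable def gen (h : IsStaircase I b n) (k : ℕ) : I :=
  ⟨mon 0 k (b k), (h.mon_mem_iff _ _ _).2 (Or.inr le_rfl)⟩

/-- Evaluation of a homomorphism `I → R ⧸ I` on generators. -/
noncomputable def evalGen (h : IsStaircase I b n) :
    (I →ₗ[Poly] Poly ⧸ I) →ₗ[ℂ] (Poly ⧸ I) × (Fin (n + 1) → Poly ⧸ I) where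
  toFun φ := (φ ⟨X 0, h.X_zero_mem⟩, fun k => φ (h.gen k))
  map_add' _ _ := rfl
  map_smul' _ _ := rfl

lemma evalGen_injective (h : IsStaircase I b n) : Function.Injective h.evalGen := by
  rw [← LinearMap.ker_eq_bot, LinearMap.ker_eq_bot']
  intro φ hφ
  have hx : φ ⟨X 0, h.X_zero_mem⟩ = 0 := congrArg Prod.fst hφ
  have hg : ∀ k ≤ n, φ (h.gen k) = 0 := fun k hk =>
    congrFun (congrArg Prod.snd hφ) ⟨k, by omega⟩
  have hle : I ≤ (LinearMap.ker φ).map I.subtype := by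
    intro p hp
    refine mem_of_support fun d hd => ?_
    have hdI := h.isMonomial p hp d hd
    rw [monomial_eq_mon] at hdI ⊢
    have hd' := (h.mon_mem_iff _ _ _).1 hdI
    refine ⟨⟨_, hdI⟩, ?_, rfl⟩
    rw [SetLike.mem_coe, LinearMap.mem_ker]
    rcases Nat.eq_zero_or_pos (d 0) with h0 | h0
    · have hb := hd'.resolve_left (by omega)
      rcases le_total (d 1) n with h1 | h1
      · have : (⟨_, hdI⟩ : I) = (X 2 ^ (d 2 - b (d 1)) : Poly) • h.gen (d 1) := by
          ext1
          change mon (d 0) (d 1) (d 2) = X 2 ^ (d 2 - b (d 1)) * mon 0 (d 1) (b (d 1))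
          rw [X_two_pow_mul_mon, h0, Nat.add_sub_cancel' hb]
        rw [this, map_smul, hg _ h1, smul_zero]
      · have : (⟨_, hdI⟩ : I) = mon 0 (d 1 - n) (d 2) • h.gen n := by
          ext1
          change mon (d 0) (d 1) (d 2) = mon 0 (d 1 - n) (d 2) * mon 0 n (b n)
          obtain ⟨c, hc⟩ := Nat.exists_eq_add_of_le h1
          rw [h.eq_zero, h0, hc, Nat.add_sub_cancel_left]
          simp only [mon]
          ring
        rw [this, map_smul, hg _ le_rfl, smul_zero]
    · have : (⟨_, hdI⟩ : I) = mon (d 0 - 1) (d 1) (d 2) • (⟨X 0, h.X_zero_mem⟩ : I) := by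
        ext1
        change mon (d 0) (d 1) (d 2) = mon (d 0 - 1) (d 1) (d 2) * X 0
        rw [mul_comm, X_zero_mul_mon, Nat.sub_add_cancel h0]
      rw [this, map_smul, hx, smul_zero]
  ext1 p
  obtain ⟨q, hq, hqp⟩ := hle p.2
  rw [← Subtype.ext hqp]
  exact hq

lemma monLift_mul (h : IsStaircase I b n) (v : ℕ → ℕ → ℕ → Poly ⧸ I) {r : Poly}
    (hr : ∀ a i j, mon a i j ∈ I → monLift v (r * mon a i j) = r • v a i j) {p : Poly}
    (hp : p ∈ I) : monLift v (r * p) = r • monLift v p := by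
  have hD := h.le_ker (monLift v ∘ₗ LinearMap.mulLeft ℂ r - mulBy I r ∘ₗ monLift v) (by
    intro a i j hm
    change monLift v (r * mon a i j) - r • monLift v (mon a i j) = 0
    rw [hr _ _ _ ((h.mon_mem_iff _ _ _).2 hm), monLift_mon, sub_self])
  exact sub_eq_zero.1 (hD hp)

lemma exists_hom (h : IsStaircase I b n) (g : Poly ⧸ I) (F : ℕ → Poly ⧸ I)
    (hF : ∀ k, (X 1 : Poly) • F k = (X 2 ^ (b k - b (k + 1)) : Poly) • F (k + 1)) :
    ∃ φ : I →ₗ[Poly] Poly ⧸ I, φ ⟨X 0, h.X_zero_mem⟩ = g ∧ ∀ k, φ (h.gen k) = F k := by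
  let v : ℕ → ℕ → ℕ → Poly ⧸ I := fun a i j =>
    if a = 0 then (X 2 ^ (j - b i) : Poly) • F i else mon (a - 1) i j • g
  have hvx : ∀ a i j, mon a i j ∈ I → v (a + 1) i j = (X 0 : Poly) • v a i j := by
    intro a i j hm
    rw [h.X_zero_smul]
    exact smul_eq_zero_of_mem hm g
  have hvy : ∀ a i j, mon a i j ∈ I → v a (i + 1) j = (X 1 : Poly) • v a i j := by
    intro a i j hm
    have hm := (h.mon_mem_iff _ _ _).1 hm
    simp only [v]
    split_ifs with ha
    · have := h.succ_le i
      have := hm.resolve_left (by omega)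
      rw [smul_comm, hF, smul_smul, ← pow_add]
      congr 2
      omega
    · rw [smul_smul, X_one_mul_mon]
  have hvz : ∀ a i j, mon a i j ∈ I → v a i (j + 1) = (X 2 : Poly) • v a i j := by
    intro a i j hm
    have hm := (h.mon_mem_iff _ _ _).1 hm
    simp only [v]
    split_ifs with ha
    · have := hm.resolve_left (by omega)
      rw [smul_smul, ← pow_succ']
      congr 2
      omega
    · rw [smul_smul, X_two_mul_mon]
  have hX : ∀ t : Fin 3, ∀ p ∈ I, monLift v (X t * p) = (X t : Poly) • monLift v p := by
    intro t p hp
    refine h.monLift_mul v (fun a i j hm => ?_) hp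
    match t with
    | 0 => rw [X_zero_mul_mon, monLift_mon, hvx _ _ _ hm]
    | 1 => rw [X_one_mul_mon, monLift_mon, hvy _ _ _ hm]
    | 2 => rw [X_two_mul_mon, monLift_mon, hvz _ _ _ hm]
  have hmul : ∀ r : Poly, ∀ p ∈ I, monLift v (r * p) = r • monLift v p := by
    intro r
    induction r using MvPolynomial.induction_on with
    | C c =>
      intro p _
      rw [C_mul', map_smul, ← algebraMap_eq, algebraMap_smul]
    | add r s hr hs =>
      intro p hp
      rw [add_mul, map_add, hr p hp, hs p hp, add_smul]
    | mul_X r t hr =>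
      intro p hp
      rw [mul_assoc, hr _ (I.mul_mem_left _ hp), hX t p hp, smul_smul]
  refine ⟨{ toFun := fun p => monLift v p
            map_add' := fun p q => map_add _ _ _
            map_smul' := fun r p => hmul r p p.2 }, ?_, fun k => ?_⟩
  · change monLift v (X 0) = g
    rw [show (X 0 : Poly) = mon 1 0 0 by simp [mon], monLift_mon]
    simp [v, mon]
  · change monLift v (mon 0 k (b k)) = F k
    rw [monLift_mon]
    simp [v]

lemma range_evalGen (h : IsStaircase I b n) :
    LinearMap.range h.evalGen = (⊤ : Submodule ℂ (Poly ⧸ I)).prod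
      (LinearMap.ker (syzygyMap I b n)) := by
  apply le_antisymm
  · rintro _ ⟨φ, rfl⟩
    refine ⟨trivial, ?_⟩
    change syzygyMap I b n (fun k => φ (h.gen k)) = 0
    ext k : 1
    rw [syzygyMap_apply, Pi.zero_apply, sub_eq_zero, ← map_smul, ← map_smul]
    congr 1
    ext1
    change X 1 * mon 0 k (b k) = X 2 ^ (b k - b (k + 1)) * mon 0 (k + 1) (b (k + 1))
    rw [X_one_mul_mon, X_two_pow_mul_mon, Nat.add_sub_cancel' (h.succ_le k)]
  · rintro ⟨g, f⟩ ⟨-, hf⟩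
    have hf : syzygyMap I b n f = 0 := hf
    obtain ⟨φ, h1, h2⟩ := h.exists_hom g
      (fun k => if hk : k < n + 1 then f ⟨k, hk⟩ else (X 1 ^ (k - n) : Poly) • f (Fin.last n)) (by
        intro k
        rcases lt_trichotomy k n with hk | hk | hk
        · rw [dif_pos (by omega), dif_pos (by omega)]
          exact sub_eq_zero.1 (congrFun hf ⟨k, hk⟩)
        · subst hk
          rw [dif_pos (by omega), dif_neg (by omega), h.eq_zero]
          simp [Fin.last]
        · rw [dif_neg (by omega), dif_neg (by omega), h.eq_zero_of_le hk.le, smul_smul,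
            ← pow_succ', Nat.zero_sub, pow_zero, one_smul]
          congr 2
          omega)
    refine ⟨φ, Prod.ext h1 ?_⟩
    ext k : 1
    exact (h2 k).trans (dif_pos k.2)

lemma tangentDim_eq (h : IsStaircase I b n) [FiniteDimensional ℂ (Poly ⧸ I)] :
    tangentDim I = 3 * Module.finrank ℂ (Poly ⧸ I) := by
  have h1 : (⊤ : Submodule ℂ (Poly ⧸ I)).prod (LinearMap.ker (syzygyMap I b n)) =
      LinearMap.range (LinearMap.prodMap LinearMap.id (LinearMap.ker (syzygyMap I b n)).subtype) := by
    rw [LinearMap.range_prodMap, LinearMap.range_id, Submodule.range_subtype]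
  have h2 : Function.Injective
      (LinearMap.prodMap (LinearMap.id : (Poly ⧸ I) →ₗ[ℂ] (Poly ⧸ I))
        (LinearMap.ker (syzygyMap I b n)).subtype) :=
    Function.injective_id.prodMap Subtype.val_injective
  rw [tangentDim, ← LinearMap.finrank_range_of_inj h.evalGen_injective, range_evalGen, h1,
    LinearMap.finrank_range_of_inj h2, Module.finrank_prod, h.finrank_ker_syzygyMap]
  ring

end IsStaircase

/-- The ideal `(x, y, z ^ l)`. -/
noncomputable def lineIdeal (l : ℕ) : Ideal Poly :=
  Ideal.span ((fun d => monomial d (1 : ℂ)) '' {d | d 0 ≠ 0 ∨ d 1 ≠ 0 ∨ l ≤ d 2})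

lemma mem_lineIdeal {l : ℕ} {p : Poly} :
    p ∈ lineIdeal l ↔ ∀ d ∈ p.support, d 0 ≠ 0 ∨ d 1 ≠ 0 ∨ l ≤ d 2 := by
  rw [lineIdeal, mem_ideal_span_monomial_image]
  refine forall₂_congr fun d _ => ⟨?_, fun hd => ⟨d, hd, le_rfl⟩⟩
  rintro ⟨e, he, hle⟩
  have h0 := hle 0
  have h1 := hle 1
  have h2 := hle 2
  simp only [Set.mem_ofPred_eq] at he
  omega

lemma monomial_mem_lineIdeal {l : ℕ} {d : Fin 3 →₀ ℕ} :
    monomial d (1 : ℂ) ∈ lineIdeal l ↔ d 0 ≠ 0 ∨ d 1 ≠ 0 ∨ l ≤ d 2 := by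
  simp [mem_lineIdeal, support_monomial]

lemma isMonomialIdeal_lineIdeal (l : ℕ) : IsMonomialIdeal (lineIdeal l) := fun _ hp d hd =>
  monomial_mem_lineIdeal.2 (mem_lineIdeal.1 hp d hd)

lemma isBorelFixed_lineIdeal (l : ℕ) : IsBorelFixed (lineIdeal l) := by
  intro d _ i j hij _
  rw [monomial_mem_lineIdeal]
  have hi : (d + Finsupp.single i 1 - Finsupp.single j 1 : Fin 3 →₀ ℕ) i ≠ 0 := by
    simp [hij.ne']
  fin_cases i
  · exact Or.inl hi
  · exact Or.inr (Or.inl hi)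
  · fin_cases j <;> simp at hij

lemma finrank_lineIdeal (l : ℕ) : Module.finrank ℂ (Poly ⧸ lineIdeal l) = l := by
  let f : Poly →ₗ[ℂ] (Fin l → ℂ) := LinearMap.pi fun k => lcoeff ℂ (Finsupp.single 2 (k : ℕ))
  have hf : ∀ p k, f p k = coeff (Finsupp.single 2 (k : ℕ)) p := fun _ _ => rfl
  have hker : LinearMap.ker f = (lineIdeal l).restrictScalars ℂ := by
    ext p
    rw [LinearMap.mem_ker, Submodule.restrictScalars_mem, mem_lineIdeal]
    constructor
    · intro hp d hd
      by_contra hne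
      push Not at hne
      have h1 := congrFun hp ⟨d 2, hne.2.2⟩
      rw [hf] at h1
      rw [mem_support_iff] at hd
      apply hd
      rw [← Pi.zero_apply (M := fun _ => ℂ) (⟨d 2, hne.2.2⟩ : Fin l), ← h1]
      congr 1
      ext t
      fin_cases t <;> simp [hne.1, hne.2.1]
    · intro hp
      ext k
      rw [hf, Pi.zero_apply]
      by_contra hne
      have := hp _ (mem_support_iff.2 hne)
      simp at this
      omega
  have hsurj : Function.Surjective f := by
    intro c
    refine ⟨∑ k : Fin l, monomial (Finsupp.single 2 (k : ℕ)) (c k), ?_⟩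
    ext k
    rw [hf, coeff_sum, Finset.sum_eq_single k]
    · simp
    · intro j _ hj
      rw [coeff_monomial, if_neg]
      intro hh
      exact hj (Fin.ext (Finsupp.single_injective _ hh))
    · simp
  rw [← (Submodule.Quotient.restrictScalarsEquiv ℂ (lineIdeal l)).finrank_eq, ← hker,
    (f.quotKerEquivOfSurjective hsurj).finrank_eq, Module.finrank_fin_fun]

end BorelTangent

/-- If `I ⊆ ℂ[x,y,z]` is a Borel-fixed monomial ideal of colength `l` with `x ∈ I`,
then `dim_ℂ Hom_R(I, R/I) = 3l`; in particular `T_{max,1}(l) = 3l` for every `l ≥ 1`. -/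
theorem tangentDim_of_x_mem (l : ℕ) :
    (∀ I : Ideal (MvPolynomial (Fin 3) ℂ),
      IsMonomialIdeal I → IsBorelFixed I →
      FiniteDimensional ℂ (MvPolynomial (Fin 3) ℂ ⧸ I) →
      Module.finrank ℂ (MvPolynomial (Fin 3) ℂ ⧸ I) = l →
      (X 0 : MvPolynomial (Fin 3) ℂ) ∈ I →
      tangentDim I = 3 * l) ∧
    (1 ≤ l → TmaxEq l 1 (3 * l)) := by
  have main : ∀ I : Ideal (MvPolynomial (Fin 3) ℂ),
      IsMonomialIdeal I → IsBorelFixed I →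
      FiniteDimensional ℂ (MvPolynomial (Fin 3) ℂ ⧸ I) →
      Module.finrank ℂ (MvPolynomial (Fin 3) ℂ ⧸ I) = l →
      (X 0 : MvPolynomial (Fin 3) ℂ) ∈ I →
      tangentDim I = 3 * l := by
    intro I hI _ _ hl hx
    obtain ⟨b, n, h⟩ := BorelTangent.exists_isStaircase hI hx
    rw [h.tangentDim_eq, hl]
  refine ⟨main, fun hl => ?_⟩
  have main' : ∀ I : Ideal (MvPolynomial (Fin 3) ℂ),
      IsMonomialIdeal I → IsBorelFixed I →
      Module.finrank ℂ (MvPolynomial (Fin 3) ℂ ⧸ I) = l →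
      (X 0 : MvPolynomial (Fin 3) ℂ) ^ 1 ∈ I → tangentDim I = 3 * l := fun I h1 h2 h3 h4 =>
    main I h1 h2 (Module.finite_of_finrank_pos (by omega)) h3 (by rwa [pow_one] at h4)
  refine ⟨⟨BorelTangent.lineIdeal l, BorelTangent.isMonomialIdeal_lineIdeal l,
    BorelTangent.isBorelFixed_lineIdeal l, BorelTangent.finrank_lineIdeal l, ?_, ?_, ?_⟩, ?_⟩
  · rw [X_pow_eq_monomial, BorelTangent.monomial_mem_lineIdeal]
    simp
  · rw [X_pow_eq_monomial, BorelTangent.monomial_mem_lineIdeal]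
    simp
    omega
  · refine (main' _ (BorelTangent.isMonomialIdeal_lineIdeal l)
      (BorelTangent.isBorelFixed_lineIdeal l) (BorelTangent.finrank_lineIdeal l) ?_).symm
    rw [X_pow_eq_monomial, BorelTangent.monomial_mem_lineIdeal]
    simp
  · rintro t ⟨I, h1, h2, h3, h4, -, rfl⟩
    exact (main' I h1 h2 h3 h4).le
end

section
/- Let R = ℂ[x,y,z] and I = (x, y, z^2)^2 ⊆ R. Then I is a Borel-fixed monomial ideal, dim_ℂ(R/I) = 8, I has exactly 6 minimal monomial generators, and dim_ℂ Hom_R(I, R/I) = 36 (which equals 6·8 − 12). -/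
open MvPolynomial

/-- The set of exponent vectors of minimal monomial generators of a monomial
ideal `I`: monomials lying in `I` such that dividing by any variable leaves `I`. -/
def minGens (I : Ideal (MvPolynomial (Fin 3) ℂ)) : Set (Fin 3 →₀ ℕ) :=
  { d | (monomial d (1 : ℂ)) ∈ I ∧
    ∀ i : Fin 3, 0 < d i → (monomial (d - Finsupp.single i 1) (1 : ℂ)) ∉ I }

/-- The exponent vector of `x ^ a * y ^ b * z ^ c`. -/
noncomputable def expVec (a b c : ℕ) : Fin 3 →₀ ℕ :=
  Finsupp.single 0 a + Finsupp.single 1 b + Finsupp.single 2 c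

@[simp] lemma expVec_zero (a b c : ℕ) : expVec a b c 0 = a := by simp [expVec]

@[simp] lemma expVec_one (a b c : ℕ) : expVec a b c 1 = b := by simp [expVec]

@[simp] lemma expVec_two (a b c : ℕ) : expVec a b c 2 = c := by simp [expVec]

lemma eq_iff_apply_fin_three (d e : Fin 3 →₀ ℕ) :
    d = e ↔ d 0 = e 0 ∧ d 1 = e 1 ∧ d 2 = e 2 := by
  rw [Finsupp.ext_iff, Fin.forall_fin_succ, Fin.forall_fin_succ, Fin.forall_fin_one]
  rfl

lemma le_iff_apply_fin_three (d e : Fin 3 →₀ ℕ) :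
    d ≤ e ↔ d 0 ≤ e 0 ∧ d 1 ≤ e 1 ∧ d 2 ≤ e 2 := by
  rw [Finsupp.le_def, Fin.forall_fin_succ, Fin.forall_fin_succ, Fin.forall_fin_one]
  rfl

/-- The order of a monomial with respect to the powers of `(x, y, z²)`. -/
def order (d : Fin 3 →₀ ℕ) : ℕ := d 0 + d 1 + d 2 / 2

lemma order_add_le (d e : Fin 3 →₀ ℕ) : order d + order e ≤ order (d + e) := by
  simp only [order, Finsupp.add_apply]
  omega

/-- The ideal of polynomials all of whose monomials have order at least `k`. -/
noncomputable def orderIdeal (k : ℕ) : Ideal (MvPolynomial (Fin 3) ℂ) where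
  carrier := {p | ∀ d, order d < k → coeff d p = 0}
  add_mem' := fun hp hq d hd => by rw [coeff_add, hp d hd, hq d hd, add_zero]
  zero_mem' := fun d _ => coeff_zero d
  smul_mem' := fun r p hp d hd => by
    rw [smul_eq_mul, coeff_mul]
    refine Finset.sum_eq_zero fun x hx => ?_
    have h := order_add_le x.1 x.2
    rw [Finset.HasAntidiagonal.mem_antidiagonal.1 hx] at h
    rw [hp x.2 (by omega), mul_zero]

lemma mem_orderIdeal {k : ℕ} {p : MvPolynomial (Fin 3) ℂ} :
    p ∈ orderIdeal k ↔ ∀ d, order d < k → coeff d p = 0 := Iff.rfl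

lemma monomial_mem_orderIdeal {k : ℕ} {d : Fin 3 →₀ ℕ} :
    monomial d (1 : ℂ) ∈ orderIdeal k ↔ k ≤ order d := by
  rw [mem_orderIdeal]
  constructor
  · intro h
    by_contra! hd
    simpa using h d hd
  · intro h e he
    rw [coeff_monomial, if_neg]
    rintro rfl
    omega

lemma mul_mem_orderIdeal {j k : ℕ} {p q : MvPolynomial (Fin 3) ℂ}
    (hp : p ∈ orderIdeal j) (hq : q ∈ orderIdeal k) : p * q ∈ orderIdeal (j + k) := by
  intro d hd
  rw [coeff_mul]
  refine Finset.sum_eq_zero fun x hx => ?_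
  have h := order_add_le x.1 x.2
  rw [Finset.HasAntidiagonal.mem_antidiagonal.1 hx] at h
  by_cases h1 : order x.1 < j
  · rw [hp x.1 h1, zero_mul]
  · rw [hq x.2 (by omega), mul_zero]

lemma X_zero_mem_orderIdeal : (X 0 : MvPolynomial (Fin 3) ℂ) ∈ orderIdeal 1 :=
  monomial_mem_orderIdeal.2 (by simp [order])

lemma X_one_mem_orderIdeal : (X 1 : MvPolynomial (Fin 3) ℂ) ∈ orderIdeal 1 :=
  monomial_mem_orderIdeal.2 (by simp [order])

lemma X_two_sq_mem_orderIdeal : (X 2 ^ 2 : MvPolynomial (Fin 3) ℂ) ∈ orderIdeal 1 := by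
  rw [X_pow_eq_monomial]
  exact monomial_mem_orderIdeal.2 (by simp [order])

/-- The exponents of the minimal generators of `(x, y, z²)²`. -/
noncomputable def genExp : Fin 6 → Fin 3 →₀ ℕ :=
  ![expVec 2 0 0, expVec 1 1 0, expVec 0 2 0, expVec 1 0 2, expVec 0 1 2, expVec 0 0 4]

/-- The exponents of the monomials of `(x, y, z²)` outside `(x, y, z²)²`. -/
noncomputable def midExp : Fin 6 → Fin 3 →₀ ℕ :=
  ![expVec 1 0 0, expVec 1 0 1, expVec 0 1 0, expVec 0 1 1, expVec 0 0 2, expVec 0 0 3]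

/-- The exponents of the monomials outside `(x, y, z²)²`. -/
noncomputable def stdExp : Fin 8 → Fin 3 →₀ ℕ :=
  ![expVec 0 0 0, expVec 0 0 1, expVec 1 0 0, expVec 1 0 1, expVec 0 1 0, expVec 0 1 1,
    expVec 0 0 2, expVec 0 0 3]

lemma genExp_injective : Function.Injective genExp := by
  intro i j h
  rw [eq_iff_apply_fin_three] at h
  fin_cases i <;> fin_cases j <;> simp [genExp] at h ⊢

lemma midExp_injective : Function.Injective midExp := by
  intro i j h
  rw [eq_iff_apply_fin_three] at h
  fin_cases i <;> fin_cases j <;> simp [midExp] at h ⊢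

lemma stdExp_injective : Function.Injective stdExp := by
  intro i j h
  rw [eq_iff_apply_fin_three] at h
  fin_cases i <;> fin_cases j <;> simp [stdExp] at h ⊢

lemma order_genExp (i : Fin 6) : order (genExp i) = 2 := by
  fin_cases i <;> simp [genExp, order]

lemma order_midExp (i : Fin 6) : order (midExp i) = 1 := by
  fin_cases i <;> simp [midExp, order]

lemma order_stdExp (i : Fin 8) : order (stdExp i) < 2 := by
  fin_cases i <;> simp [stdExp, order]

lemma exists_genExp_le {d : Fin 3 →₀ ℕ} (hd : 2 ≤ order d) : ∃ i, genExp i ≤ d := by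
  simp only [Fin.exists_fin_succ, le_iff_apply_fin_three, genExp]
  simp
  simp only [order] at hd
  omega

lemma exists_midExp_eq {d : Fin 3 →₀ ℕ} (hd : order d = 1) : ∃ i, midExp i = d := by
  simp only [Fin.exists_fin_succ, eq_iff_apply_fin_three, midExp]
  simp
  simp only [order] at hd
  omega

lemma exists_stdExp_eq {d : Fin 3 →₀ ℕ} (hd : order d < 2) : ∃ i, stdExp i = d := by
  simp only [Fin.exists_fin_succ, eq_iff_apply_fin_three, stdExp]
  simp
  simp only [order] at hd
  omega

lemma orderIdeal_two_le_span :
    orderIdeal 2 ≤ Ideal.span (Set.range fun i => monomial (genExp i) (1 : ℂ)) := by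
  intro p hp
  rw [← support_sum_monomial_coeff p]
  refine Ideal.sum_mem _ fun d hd => ?_
  have h2 : 2 ≤ order d := by
    by_contra! h
    exact mem_support_iff.1 hd (hp d h)
  obtain ⟨i, hi⟩ := exists_genExp_le h2
  have h : monomial d (coeff d p) =
      monomial (d - genExp i) (coeff d p) * monomial (genExp i) (1 : ℂ) := by
    rw [monomial_mul, tsub_add_cancel_of_le hi, mul_one]
  rw [h]
  exact Ideal.mul_mem_left _ _ (Ideal.subset_span ⟨i, rfl⟩)

lemma span_sq_eq_orderIdeal :
    (Ideal.span {X 0, X 1, (X 2) ^ 2} : Ideal (MvPolynomial (Fin 3) ℂ)) ^ 2 = orderIdeal 2 := by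
  apply le_antisymm
  · have h : (Ideal.span {X 0, X 1, (X 2) ^ 2} : Ideal (MvPolynomial (Fin 3) ℂ)) ≤
        orderIdeal 1 := by
      rw [Ideal.span_le]
      rintro p (rfl | rfl | rfl)
      exacts [X_zero_mem_orderIdeal, X_one_mem_orderIdeal, X_two_sq_mem_orderIdeal]
    rw [pow_two, Ideal.mul_le]
    exact fun p hp q hq => mul_mem_orderIdeal (h hp) (h hq)
  · refine orderIdeal_two_le_span.trans (Ideal.span_le.2 ?_)
    rintro _ ⟨i, rfl⟩
    have h0 : (X 0 : MvPolynomial (Fin 3) ℂ) ∈ Ideal.span {X 0, X 1, (X 2) ^ 2} :=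
      Ideal.subset_span (by simp)
    have h1 : (X 1 : MvPolynomial (Fin 3) ℂ) ∈ Ideal.span {X 0, X 1, (X 2) ^ 2} :=
      Ideal.subset_span (by simp)
    have h2 : (X 2 ^ 2 : MvPolynomial (Fin 3) ℂ) ∈ Ideal.span {X 0, X 1, (X 2) ^ 2} :=
      Ideal.subset_span (by simp)
    have hmon (a b c : ℕ) : monomial (expVec a b c) (1 : ℂ) = X 0 ^ a * X 1 ^ b * X 2 ^ c := by
      simp [expVec, X_pow_eq_monomial, monomial_mul]
    rw [pow_two, SetLike.mem_coe]
    fin_cases i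
    · convert Ideal.mul_mem_mul h0 h0 using 1
      simp [genExp, hmon]; ring
    · convert Ideal.mul_mem_mul h0 h1 using 1
      simp [genExp, hmon]
    · convert Ideal.mul_mem_mul h1 h1 using 1
      simp [genExp, hmon]; ring
    · convert Ideal.mul_mem_mul h0 h2 using 1
      simp [genExp, hmon]
    · convert Ideal.mul_mem_mul h1 h2 using 1
      simp [genExp, hmon]
    · convert Ideal.mul_mem_mul h2 h2 using 1
      simp [genExp, hmon]; ring

lemma isMonomialIdeal_orderIdeal (k : ℕ) : IsMonomialIdeal (orderIdeal k) := by
  intro p hp d hd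
  rw [monomial_mem_orderIdeal]
  by_contra! h
  exact mem_support_iff.1 hd (hp d h)

lemma isBorelFixed_orderIdeal (k : ℕ) : IsBorelFixed (orderIdeal k) := by
  intro d hd i j hij hj
  rw [monomial_mem_orderIdeal] at hd ⊢
  refine hd.trans ?_
  fin_cases i <;> fin_cases j <;> simp [order] at hij hj ⊢ <;> omega

lemma minGens_orderIdeal_two : minGens (orderIdeal 2) = Set.range genExp := by
  ext d
  simp only [minGens, Set.mem_ofPred_eq, monomial_mem_orderIdeal, Set.mem_range]
  constructor
  · rintro ⟨h2, hmin⟩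
    obtain ⟨i, hi⟩ := exists_genExp_le h2
    refine ⟨i, hi.antisymm ?_⟩
    intro j
    by_contra! hj
    refine hmin j (by omega) ?_
    rw [← order_genExp i]
    have hle : genExp i ≤ d - Finsupp.single j 1 := by
      intro k
      have := hi k
      by_cases hk : j = k
      · subst hk
        simp
        omega
      · simpa [Finsupp.single_apply, hk] using this
    rw [le_iff_apply_fin_three] at hle
    simp only [order]
    omega
  · rintro ⟨i, rfl⟩
    refine ⟨(order_genExp i).ge, ?_⟩
    intro j hj
    fin_cases i <;> fin_cases j <;> simp [genExp, order] at hj ⊢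

lemma ncard_minGens_orderIdeal_two : (minGens (orderIdeal 2)).ncard = 6 := by
  rw [minGens_orderIdeal_two, ← Nat.card_coe_set_eq, Nat.card_range_of_injective genExp_injective,
    Nat.card_fin]

/-- The coefficient of a monomial of order less than `k` as a functional on `R ⧸ orderIdeal k`. -/
noncomputable def quotCoeff {k : ℕ} (d : Fin 3 →₀ ℕ) (hd : order d < k) :
    (MvPolynomial (Fin 3) ℂ ⧸ orderIdeal k) →ₗ[ℂ] ℂ :=
  ((orderIdeal k).restrictScalars ℂ).liftQ (lcoeff ℂ d) (fun _ hp => hp d hd) ∘ₗ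
    (Submodule.Quotient.restrictScalarsEquiv ℂ (orderIdeal k)).symm.toLinearMap

@[simp] lemma quotCoeff_mk {k : ℕ} (d : Fin 3 →₀ ℕ) (hd : order d < k)
    (p : MvPolynomial (Fin 3) ℂ) :
    quotCoeff d hd (Ideal.Quotient.mk (orderIdeal k) p) = coeff d p := rfl

lemma finrank_quotient_orderIdeal_two :
    Module.finrank ℂ (MvPolynomial (Fin 3) ℂ ⧸ orderIdeal 2) = 8 := by
  let f : (MvPolynomial (Fin 3) ℂ ⧸ orderIdeal 2) →ₗ[ℂ] (Fin 8 → ℂ) :=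
    LinearMap.pi fun i => quotCoeff (stdExp i) (order_stdExp i)
  have hinj : Function.Injective f := by
    rw [injective_iff_map_eq_zero]
    intro s hs
    obtain ⟨p, rfl⟩ := Ideal.Quotient.mk_surjective s
    rw [Ideal.Quotient.eq_zero_iff_mem]
    intro d hd
    obtain ⟨i, rfl⟩ := exists_stdExp_eq hd
    exact congrFun hs i
  have hsurj : Function.Surjective f := by
    intro a
    refine ⟨Ideal.Quotient.mk _ (∑ i, monomial (stdExp i) (a i)), ?_⟩
    ext j
    simp [f, coeff_monomial, stdExp_injective.eq_iff]
  rw [(LinearEquiv.ofBijective f ⟨hinj, hsurj⟩).finrank_eq, Module.finrank_fin_fun]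

/-- Each generator of `(x, y, z²)²` is involved in a syzygy `u * g = v * g'` with `u ≠ v`
among `x, y, z²`. -/
lemma exists_syzygy (i : Fin 6) : ∃ (j : Fin 6) (u v : Fin 3 →₀ ℕ),
    u + genExp i = v + genExp j ∧ ∀ d, order d < 1 → order (u + d) < 2 ∧ ¬ v ≤ u + d := by
  have key (j : Fin 6) (u v : Fin 3 →₀ ℕ) (h : u + genExp i = v + genExp j)
      (hu : order u = 1) (hu2 : Even (u 2)) (hv : order v = 1) (hv2 : Even (v 2)) (huv : u ≠ v) :
      ∃ (j : Fin 6) (u v : Fin 3 →₀ ℕ),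
        u + genExp i = v + genExp j ∧
          ∀ d, order d < 1 → order (u + d) < 2 ∧ ¬ v ≤ u + d := by
    refine ⟨j, u, v, h, fun d hd => ?_⟩
    rw [Ne, eq_iff_apply_fin_three] at huv
    rw [le_iff_apply_fin_three]
    obtain ⟨a, ha⟩ := hu2
    obtain ⟨b, hb⟩ := hv2
    simp only [order, Finsupp.add_apply] at *
    omega
  fin_cases i
  · refine key 1 (expVec 0 1 0) (expVec 1 0 0) ?_ ?_ ?_ ?_ ?_ ?_ <;>
      simp [eq_iff_apply_fin_three, genExp, order]
  · refine key 0 (expVec 1 0 0) (expVec 0 1 0) ?_ ?_ ?_ ?_ ?_ ?_ <;>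
      simp [eq_iff_apply_fin_three, genExp, order]
  · refine key 1 (expVec 1 0 0) (expVec 0 1 0) ?_ ?_ ?_ ?_ ?_ ?_ <;>
      simp [eq_iff_apply_fin_three, genExp, order]
  · refine key 0 (expVec 1 0 0) (expVec 0 0 2) ?_ ?_ ?_ ?_ ?_ ?_ <;>
      simp [eq_iff_apply_fin_three, genExp, order]
  · refine key 2 (expVec 0 1 0) (expVec 0 0 2) ?_ ?_ ?_ ?_ ?_ ?_ <;>
      simp [eq_iff_apply_fin_three, genExp, order]
  · refine key 3 (expVec 1 0 0) (expVec 0 0 2) ?_ ?_ ?_ ?_ ?_ ?_ <;>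
      simp [eq_iff_apply_fin_three, genExp, order]

/-- The generator of `(x, y, z²)²` with exponent `genExp i`. -/
noncomputable def gen (i : Fin 6) : orderIdeal 2 :=
  ⟨monomial (genExp i) 1, monomial_mem_orderIdeal.2 (order_genExp i).ge⟩

lemma mem_orderIdeal_one_of_apply_gen
    (φ : orderIdeal 2 →ₗ[MvPolynomial (Fin 3) ℂ] (MvPolynomial (Fin 3) ℂ ⧸ orderIdeal 2))
    (i : Fin 6) {p : MvPolynomial (Fin 3) ℂ} (hp : φ (gen i) = Ideal.Quotient.mk _ p) :
    p ∈ orderIdeal 1 := by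
  obtain ⟨j, u, v, huv, h⟩ := exists_syzygy i
  obtain ⟨q, hq⟩ := Ideal.Quotient.mk_surjective (φ (gen j))
  have hsyz : (monomial u (1 : ℂ)) • gen i = (monomial v (1 : ℂ)) • gen j := by
    apply Subtype.ext
    simp [gen, monomial_mul, huv]
  have hφ := congrArg φ hsyz
  rw [map_smul, map_smul, hp, ← hq] at hφ
  have hmem : monomial u (1 : ℂ) * p - monomial v (1 : ℂ) * q ∈ orderIdeal 2 :=
    Ideal.Quotient.eq.1 hφ
  intro d hd
  obtain ⟨h2, hle⟩ := h d hd
  have := hmem (u + d) h2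
  rw [coeff_sub, coeff_monomial_mul, coeff_monomial_mul', if_neg hle] at this
  simpa using this

lemma hom_ext_gen
    {φ : orderIdeal 2 →ₗ[MvPolynomial (Fin 3) ℂ] (MvPolynomial (Fin 3) ℂ ⧸ orderIdeal 2)}
    (h : ∀ i, φ (gen i) = 0) : φ = 0 := by
  have hle : orderIdeal 2 ≤ (LinearMap.ker φ).map (orderIdeal 2).subtype := by
    refine orderIdeal_two_le_span.trans (Submodule.span_le.2 ?_)
    rintro _ ⟨i, rfl⟩
    exact ⟨gen i, h i, rfl⟩
  ext p
  obtain ⟨q, hq, hqp⟩ := hle p.2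
  rw [← show q = p from Subtype.ext hqp]
  exact hq

lemma coeff_genExp_X_mul {p : MvPolynomial (Fin 3) ℂ} (hp : p ∈ orderIdeal 2) (i : Fin 6)
    (k : Fin 3) : coeff (genExp i) (X k * p) = 0 := by
  rw [coeff_X_mul']
  split_ifs with hk
  · apply hp
    rw [Finsupp.mem_support_iff] at hk
    fin_cases i <;> fin_cases k <;> simp [genExp, order] at hk ⊢
  · rfl

lemma coeff_genExp_add_X_mul {p : MvPolynomial (Fin 3) ℂ} (hp : p ∈ orderIdeal 2) (i : Fin 6)
    {k : Fin 3} (hk2 : k ≠ 2) : coeff (genExp i + Finsupp.single 2 1) (X k * p) = 0 := by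
  rw [coeff_X_mul']
  split_ifs with hk
  · apply hp
    rw [Finsupp.mem_support_iff] at hk
    fin_cases i <;> fin_cases k <;> simp [genExp, order] at hk hk2 ⊢
  · rfl

/-- The `ℂ`-linear map on `(x, y, z²)²` sending each generator `g i` to `n i` and `z * g i`
to `z * n i`. -/
noncomputable def homOfValuesAux (n : Fin 6 → MvPolynomial (Fin 3) ℂ) :
    MvPolynomial (Fin 3) ℂ →ₗ[ℂ] MvPolynomial (Fin 3) ℂ :=
  ∑ i, ((lcoeff ℂ (genExp i)).smulRight (n i) +
    (lcoeff ℂ (genExp i + Finsupp.single 2 1)).smulRight (X 2 * n i))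

lemma homOfValuesAux_apply (n : Fin 6 → MvPolynomial (Fin 3) ℂ) (p : MvPolynomial (Fin 3) ℂ) :
    homOfValuesAux n p = ∑ i, (coeff (genExp i) p • n i +
      coeff (genExp i + Finsupp.single 2 1) p • (X 2 * n i)) := by
  simp [homOfValuesAux, LinearMap.sum_apply]

lemma homOfValuesAux_X_mul {n : Fin 6 → MvPolynomial (Fin 3) ℂ} (hn : ∀ i, n i ∈ orderIdeal 1)
    (k : Fin 3) {p : MvPolynomial (Fin 3) ℂ} (hp : p ∈ orderIdeal 2) :
    X k * homOfValuesAux n p - homOfValuesAux n (X k * p) ∈ orderIdeal 2 := by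
  simp only [homOfValuesAux_apply, Finset.mul_sum, ← Finset.sum_sub_distrib]
  refine Ideal.sum_mem _ fun i _ => ?_
  rw [coeff_genExp_X_mul hp]
  by_cases hk : k = 2
  · subst hk
    rw [add_comm (genExp i), coeff_X_mul]
    have h := mul_mem_orderIdeal X_two_sq_mem_orderIdeal (hn i)
    convert Ideal.mul_mem_left _ (C (coeff (Finsupp.single 2 1 + genExp i) p)) h using 1
    simp only [smul_eq_C_mul, map_zero]
    ring
  · rw [coeff_genExp_add_X_mul hp i hk]
    have hX : (X k : MvPolynomial (Fin 3) ℂ) ∈ orderIdeal 1 := by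
      fin_cases k
      exacts [X_zero_mem_orderIdeal, X_one_mem_orderIdeal, absurd rfl hk]
    convert Ideal.mul_mem_left _ (C (coeff (genExp i) p) +
      C (coeff (genExp i + Finsupp.single 2 1) p) * X 2) (mul_mem_orderIdeal hX (hn i)) using 1
    simp only [smul_eq_C_mul, map_zero]
    ring

lemma homOfValuesAux_mul {n : Fin 6 → MvPolynomial (Fin 3) ℂ} (hn : ∀ i, n i ∈ orderIdeal 1)
    (r : MvPolynomial (Fin 3) ℂ) {p : MvPolynomial (Fin 3) ℂ} (hp : p ∈ orderIdeal 2) :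
    r * homOfValuesAux n p - homOfValuesAux n (r * p) ∈ orderIdeal 2 := by
  induction r using MvPolynomial.induction_on generalizing p with
  | C a => simp [← smul_eq_C_mul]
  | add r s hr hs =>
    convert add_mem (hr hp) (hs hp) using 1
    rw [add_mul r s p, map_add]
    ring
  | mul_X r k hr =>
    convert add_mem (Ideal.mul_mem_left _ r (homOfValuesAux_X_mul hn k hp))
      (hr (Ideal.mul_mem_left _ (X k) hp)) using 1
    rw [mul_assoc r (X k) p]
    ring

/-- The homomorphism `(x, y, z²)² → R ⧸ (x, y, z²)²` with prescribed values
in `(x, y, z²)` on the generators. -/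
noncomputable def homOfValues (n : Fin 6 → MvPolynomial (Fin 3) ℂ)
    (hn : ∀ i, n i ∈ orderIdeal 1) :
    orderIdeal 2 →ₗ[MvPolynomial (Fin 3) ℂ] (MvPolynomial (Fin 3) ℂ ⧸ orderIdeal 2) where
  toFun p := Ideal.Quotient.mk _ (homOfValuesAux n p)
  map_add' p q := by simp
  map_smul' r p := (Ideal.Quotient.eq.2 (homOfValuesAux_mul hn r p.2)).symm

lemma homOfValues_gen (n : Fin 6 → MvPolynomial (Fin 3) ℂ) (hn : ∀ i, n i ∈ orderIdeal 1)
    (i : Fin 6) : homOfValues n hn (gen i) = Ideal.Quotient.mk _ (n i) := by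
  have hne (j : Fin 6) : genExp i ≠ genExp j + Finsupp.single 2 1 := by
    rw [Ne, eq_iff_apply_fin_three]
    fin_cases i <;> fin_cases j <;> simp [genExp]
  change Ideal.Quotient.mk _ (homOfValuesAux n (monomial (genExp i) 1)) = _
  simp [homOfValuesAux_apply, coeff_monomial, genExp_injective.eq_iff, hne]

lemma tangentDim_orderIdeal_two : tangentDim (orderIdeal 2) = 36 := by
  have hmid (j : Fin 6) : order (midExp j) < 2 := by
    rw [order_midExp]
    exact one_lt_two
  let f : (orderIdeal 2 →ₗ[MvPolynomial (Fin 3) ℂ] (MvPolynomial (Fin 3) ℂ ⧸ orderIdeal 2))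
      →ₗ[ℂ] (Fin 6 × Fin 6 → ℂ) :=
    { toFun := fun φ ij => quotCoeff (midExp ij.2) (hmid ij.2) (φ (gen ij.1))
      map_add' := fun φ ψ => by ext; simp
      map_smul' := fun c φ => by ext; simp }
  have hinj : Function.Injective f := by
    rw [injective_iff_map_eq_zero]
    intro φ hφ
    refine hom_ext_gen fun i => ?_
    obtain ⟨p, hp⟩ := Ideal.Quotient.mk_surjective (φ (gen i))
    rw [← hp, Ideal.Quotient.eq_zero_iff_mem]
    intro d hd
    by_cases h1 : order d < 1
    · exact mem_orderIdeal_one_of_apply_gen φ i hp.symm d h1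
    · obtain ⟨j, rfl⟩ := exists_midExp_eq (show order d = 1 by omega)
      have h := congrFun hφ (i, j)
      simpa [f, ← hp] using h
  have hsurj : Function.Surjective f := by
    intro a
    refine ⟨homOfValues (fun i => ∑ j, C (a (i, j)) * monomial (midExp j) 1) fun i =>
      Ideal.sum_mem _ fun j _ => Ideal.mul_mem_left _ _
        (monomial_mem_orderIdeal.2 (order_midExp j).ge), ?_⟩
    ext ⟨i, j⟩
    simp only [f, LinearMap.coe_mk, AddHom.coe_mk, homOfValues_gen, quotCoeff_mk]
    simp [coeff_sum, coeff_C_mul, coeff_monomial, midExp_injective.eq_iff]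
  rw [tangentDim, (LinearEquiv.ofBijective f ⟨hinj, hsurj⟩).finrank_eq, Module.finrank_pi]
  simp

/-- For `I = (x, y, z²)² ⊆ ℂ[x,y,z]`: `I` is a Borel-fixed monomial ideal,
`dim_ℂ(R/I) = 8`, `I` has exactly `6` minimal monomial generators, and
`dim_ℂ Hom_R(I, R/I) = 36 = 6·8 − 12`. -/
theorem example_x_y_zsq_squared :
    let I : Ideal (MvPolynomial (Fin 3) ℂ) :=
      (Ideal.span {X 0, X 1, (X 2) ^ 2}) ^ 2
    IsMonomialIdeal I ∧ IsBorelFixed I ∧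
    Module.finrank ℂ (MvPolynomial (Fin 3) ℂ ⧸ I) = 8 ∧
    (minGens I).ncard = 6 ∧
    tangentDim I = 36 ∧ (36 : ℕ) = 6 * 8 - 12 := by
  intro I
  have hI : I = orderIdeal 2 := span_sq_eq_orderIdeal
  rw [hI]
  exact ⟨isMonomialIdeal_orderIdeal 2, isBorelFixed_orderIdeal 2,
    finrank_quotient_orderIdeal_two, ncard_minGens_orderIdeal_two,
    tangentDim_orderIdeal_two, rfl⟩
end

section
/- T_{max,2}(10) = 46 and T_{max,3}(10) = 60; in particular, for l = 10 the function m1 ↦ T_{max,m1}(10) is strictly increasing on {1, 2, 3}. -/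
open MvPolynomial

namespace BorelTangent

section Quotient

variable {I : Ideal (MvPolynomial (Fin 3) ℂ)}

/-- The exponents of the standard monomials of `I`. -/
def stdExps (I : Ideal (MvPolynomial (Fin 3) ℂ)) : Set (Fin 3 →₀ ℕ) :=
  {d | monomial d (1 : ℂ) ∉ I}

lemma monomial_mem_of_le {d e : Fin 3 →₀ ℕ} (h : d ≤ e) (hd : monomial d (1 : ℂ) ∈ I) :
    monomial e (1 : ℂ) ∈ I := by
  have : monomial e (1 : ℂ) = monomial (e - d) 1 * monomial d 1 := by
    rw [monomial_mul, tsub_add_cancel_of_le h, one_mul]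
  exact this ▸ I.mul_mem_left _ hd

lemma mem_stdExps_of_le {d e : Fin 3 →₀ ℕ} (h : d ≤ e) (he : e ∈ stdExps I) : d ∈ stdExps I :=
  fun hd => he (monomial_mem_of_le h hd)

lemma coeff_eq_zero_of_mem (hI : IsMonomialIdeal I) {d : Fin 3 →₀ ℕ} (hd : d ∈ stdExps I)
    {p : MvPolynomial (Fin 3) ℂ} (hp : p ∈ I) : coeff d p = 0 := by
  by_contra h
  exact hd (hI p hp d (mem_support_iff.mpr h))

lemma mem_of_coeff_eq_zero {p : MvPolynomial (Fin 3) ℂ}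
    (h : ∀ d ∈ stdExps I, coeff d p = 0) : p ∈ I := by
  rw [p.as_sum]
  refine I.sum_mem fun d hd => ?_
  have hdI : monomial d (1 : ℂ) ∈ I := by
    by_contra hn
    exact mem_support_iff.mp hd (h d hn)
  have : monomial d (coeff d p) = C (coeff d p) * monomial d 1 := by
    rw [C_mul_monomial, mul_one]
  exact this ▸ I.mul_mem_left _ hdI

/-- The coefficient of the standard monomial with exponent `d` of a class modulo `I`. -/
noncomputable def coeffQ (hI : IsMonomialIdeal I) (d : stdExps I) :
    (MvPolynomial (Fin 3) ℂ ⧸ I) →ₗ[ℂ] ℂ :=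
  Submodule.liftQ (I.restrictScalars ℂ) (lcoeff ℂ d.1) fun _ hp =>
    coeff_eq_zero_of_mem hI d.2 hp

lemma coeffQ_mk (hI : IsMonomialIdeal I) (d : stdExps I) (p : MvPolynomial (Fin 3) ℂ) :
    coeffQ hI d (Ideal.Quotient.mk I p) = coeff d.1 p :=
  rfl

lemma eq_zero_of_coeffQ (hI : IsMonomialIdeal I) {q : MvPolynomial (Fin 3) ℂ ⧸ I}
    (h : ∀ d, coeffQ hI d q = 0) : q = 0 := by
  obtain ⟨p, rfl⟩ := Ideal.Quotient.mk_surjective q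
  exact Ideal.Quotient.eq_zero_iff_mem.mpr (mem_of_coeff_eq_zero fun d hd => h ⟨d, hd⟩)

lemma coeffQ_monomial_smul (hI : IsMonomialIdeal I) (d : stdExps I) {e : Fin 3 →₀ ℕ}
    (h : e ≤ d.1) (q : MvPolynomial (Fin 3) ℂ ⧸ I) :
    coeffQ hI d (monomial e (1 : ℂ) • q) =
      coeffQ hI ⟨d.1 - e, mem_stdExps_of_le tsub_le_self d.2⟩ q := by
  obtain ⟨p, rfl⟩ := Ideal.Quotient.mk_surjective q
  rw [coeffQ_mk, show monomial e (1 : ℂ) • Ideal.Quotient.mk I p =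
    Ideal.Quotient.mk I (monomial e 1 * p) from rfl, coeffQ_mk, coeff_monomial_mul', if_pos h,
    one_mul]

lemma coeffQ_monomial_smul_of_not_le (hI : IsMonomialIdeal I) (d : stdExps I) {e : Fin 3 →₀ ℕ}
    (h : ¬ e ≤ d.1) (q : MvPolynomial (Fin 3) ℂ ⧸ I) :
    coeffQ hI d (monomial e (1 : ℂ) • q) = 0 := by
  obtain ⟨p, rfl⟩ := Ideal.Quotient.mk_surjective q
  rw [show monomial e (1 : ℂ) • Ideal.Quotient.mk I p =
    Ideal.Quotient.mk I (monomial e 1 * p) from rfl, coeffQ_mk, coeff_monomial_mul', if_neg h]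

lemma finrank_quotient (hI : IsMonomialIdeal I) :
    Module.finrank ℂ (MvPolynomial (Fin 3) ℂ ⧸ I) = (stdExps I).ncard := by
  classical
  let v : stdExps I → MvPolynomial (Fin 3) ℂ ⧸ I := fun d =>
    Ideal.Quotient.mk I (monomial d.1 1)
  have hv : ∀ d e, coeffQ hI d (v e) = if e = d then 1 else 0 := fun d e => by
    rw [coeffQ_mk, coeff_monomial]
    simp only [Subtype.ext_iff]
  have li : LinearIndependent ℂ v := by
    rw [linearIndependent_iff']
    intro s c hc d hd
    have := congrArg (coeffQ hI d) hc
    simpa [hv, hd] using this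
  have sp : ⊤ ≤ Submodule.span ℂ (Set.range v) := by
    rintro q -
    obtain ⟨p, rfl⟩ := Ideal.Quotient.mk_surjective q
    rw [p.as_sum, map_sum]
    refine Submodule.sum_mem _ fun d _ => ?_
    by_cases hd : monomial d (1 : ℂ) ∈ I
    · have : Ideal.Quotient.mk I (monomial d (coeff d p)) = 0 := by
        rw [Ideal.Quotient.eq_zero_iff_mem, ← mul_one (coeff d p), ← C_mul_monomial]
        exact I.mul_mem_left _ hd
      exact this ▸ Submodule.zero_mem _
    · have : Ideal.Quotient.mk I (monomial d (coeff d p)) = coeff d p • v ⟨d, hd⟩ := by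
        conv_lhs => rw [← mul_one (coeff d p), ← smul_eq_mul, ← smul_monomial]
        rfl
      exact this ▸ Submodule.smul_mem _ _ (Submodule.subset_span ⟨_, rfl⟩)
  rw [Module.finrank_eq_nat_card_basis (Module.Basis.mk li sp), Nat.card_coe_set_eq]

end Quotient

section Hom

variable {I : Ideal (MvPolynomial (Fin 3) ℂ)}

/-- The coefficient of the standard monomial `b` in the image of the monomial `g ∈ I`, as a
linear functional on the tangent space. -/
noncomputable def ev (hI : IsMonomialIdeal I) (g : {d // monomial d (1 : ℂ) ∈ I})
    (b : stdExps I) :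
    (↥I →ₗ[MvPolynomial (Fin 3) ℂ] (MvPolynomial (Fin 3) ℂ ⧸ I)) →ₗ[ℂ] ℂ where
  toFun φ := coeffQ hI b (φ ⟨_, g.2⟩)
  map_add' φ ψ := by simp
  map_smul' c φ := by simp

lemma map_monomial_add (φ : ↥I →ₗ[MvPolynomial (Fin 3) ℂ] (MvPolynomial (Fin 3) ℂ ⧸ I))
    {g m e : Fin 3 →₀ ℕ} (hg : monomial g (1 : ℂ) ∈ I) (hm : monomial m (1 : ℂ) ∈ I)
    (h : m = e + g) : φ ⟨_, hm⟩ = monomial e (1 : ℂ) • φ ⟨_, hg⟩ := by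
  rw [← map_smul]
  congr 1
  ext1
  simp [h, monomial_mul]

/-- Compare the two ways of reaching the coefficient of `t` in the image of `g + (t - b)`:
from the generator `g`, and from another monomial `m` dividing `g + (t - b)`. -/
lemma ev_eq_coeffQ (hI : IsMonomialIdeal I) (g m : {d // monomial d (1 : ℂ) ∈ I})
    (b t : stdExps I) (hbt : b.1 ≤ t.1) (hm : m.1 ≤ g.1 + (t.1 - b.1))
    (φ : ↥I →ₗ[MvPolynomial (Fin 3) ℂ] (MvPolynomial (Fin 3) ℂ ⧸ I)) :
    ev hI g b φ =
      coeffQ hI t (monomial (g.1 + (t.1 - b.1) - m.1) (1 : ℂ) • φ ⟨_, m.2⟩) := by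
  have hL : monomial (g.1 + (t.1 - b.1)) (1 : ℂ) ∈ I := monomial_mem_of_le le_self_add g.2
  rw [← map_monomial_add φ m.2 hL (tsub_add_cancel_of_le hm).symm,
    map_monomial_add φ g.2 hL (add_comm _ _), coeffQ_monomial_smul hI t tsub_le_self]
  have : b = ⟨t.1 - (t.1 - b.1), mem_stdExps_of_le tsub_le_self t.2⟩ :=
    Subtype.ext (tsub_tsub_cancel_of_le hbt).symm
  rw [← this]
  rfl

lemma eq_zero_of_ev (hI : IsMonomialIdeal I) (G : Set {d // monomial d (1 : ℂ) ∈ I})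
    (hG : ∀ d, monomial d (1 : ℂ) ∈ I → ∃ g ∈ G, g.1 ≤ d)
    (φ : ↥I →ₗ[MvPolynomial (Fin 3) ℂ] (MvPolynomial (Fin 3) ℂ ⧸ I))
    (h : ∀ g ∈ G, ∀ b, ev hI g b φ = 0) : φ = 0 := by
  have hmon : ∀ d (hd : monomial d (1 : ℂ) ∈ I), φ ⟨_, hd⟩ = 0 := fun d hd => by
    obtain ⟨g, hg, hgd⟩ := hG d hd
    rw [map_monomial_add φ g.2 hd (tsub_add_cancel_of_le hgd).symm,
      eq_zero_of_coeffQ hI (h g hg), smul_zero]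
  refine LinearMap.ext fun ⟨p, hp⟩ => ?_
  have : (⟨p, hp⟩ : I) = ∑ d : p.support,
      (C (coeff d.1 p) : MvPolynomial (Fin 3) ℂ) • (⟨monomial d.1 1, hI p hp d.1 d.2⟩ : I) := by
    ext1
    simp only [AddSubmonoidClass.coe_finsetSum, SetLike.val_smul, smul_eq_mul, C_mul_monomial,
      mul_one]
    conv_lhs => rw [p.as_sum]
    exact (Finset.sum_coe_sort p.support fun d => monomial d (coeff d p)).symm
  rw [this, map_sum]
  refine Finset.sum_eq_zero fun d _ => ?_
  rw [map_smul, hmon, smul_zero]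

/-- The homomorphism sending the monomial `g` to `b` and all other minimal generators to `0`. -/
noncomputable def elementaryHom (hI : IsMonomialIdeal I) (g : Fin 3 →₀ ℕ) (b : Fin 3 →₀ ℕ)
    (h : ∀ t ∈ stdExps I, b ≤ t → ∀ m, monomial m (1 : ℂ) ∈ I → m ≤ g + (t - b) → g ≤ m) :
    ↥I →ₗ[MvPolynomial (Fin 3) ℂ] (MvPolynomial (Fin 3) ℂ ⧸ I) where
  toFun f := Ideal.Quotient.mk I (monomial b 1 * divMonomial f.1 g)
  map_add' f f' := by simp [add_divMonomial, mul_add]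
  map_smul' r f := by
    simp only [RingHom.id_apply, SetLike.val_smul, smul_eq_mul]
    have key : ∀ (e : Fin 3 →₀ ℕ) (c : ℂ),
        Ideal.Quotient.mk I (monomial b 1 * divMonomial (monomial e c * f.1) g) =
          Ideal.Quotient.mk I (monomial e c * (monomial b 1 * divMonomial f.1 g)) := by
      intro e c
      rw [← sub_eq_zero]
      refine eq_zero_of_coeffQ hI fun d => ?_
      rw [map_sub, sub_eq_zero, coeffQ_mk, coeffQ_mk]
      simp only [coeff_monomial_mul', coeff_divMonomial, one_mul]
      by_cases hb : b ≤ d.1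
      · rw [if_pos hb]
        by_cases he : e ≤ d.1 - b
        · have h1 : e ≤ g + (d.1 - b) := he.trans le_add_self
          have h2 : e ≤ d.1 := he.trans tsub_le_self
          have h3 : b ≤ d.1 - e := by
            rw [le_tsub_iff_right h2, add_comm]
            exact (le_tsub_iff_right hb).mp he
          rw [if_pos h1, if_pos h2, if_pos h3, add_tsub_assoc_of_le he, tsub_right_comm]
        · have h3 : ¬ (e ≤ d.1 ∧ b ≤ d.1 - e) := fun ⟨h2, h3⟩ => he <| by
            rw [le_tsub_iff_right hb, add_comm]
            exact (le_tsub_iff_right h2).mp h3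
          have hr : (if e ≤ d.1 then c * (if b ≤ d.1 - e then
              coeff (g + (d.1 - e - b)) f.1 else 0) else 0) = 0 := by
            split_ifs with h2 h4
            · exact absurd ⟨h2, h4⟩ h3
            · simp
            · rfl
          rw [hr]
          split_ifs with h1
          · rw [mul_eq_zero]
            right
            by_contra hne
            have hm := hI _ f.2 _ (mem_support_iff.mpr hne)
            have hgm := h d.1 d.2 hb _ hm tsub_le_self
            refine he ((add_le_add_iff_left g).mp ?_)
            calc g + e ≤ (g + (d.1 - b) - e) + e := by gcongr
              _ = g + (d.1 - b) := tsub_add_cancel_of_le h1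
          · rfl
      · rw [if_neg hb]
        split_ifs with h1 h2
        · exact absurd (h2.trans tsub_le_self) hb
        · simp
        · rfl
    rw [show r • Ideal.Quotient.mk I (monomial b 1 * divMonomial f.1 g) =
      Ideal.Quotient.mk I (r * (monomial b 1 * divMonomial f.1 g)) from rfl]
    induction r using MvPolynomial.induction_on' with
    | monomial e c => exact key e c
    | add p q hp hq =>
      simp only [add_mul, add_divMonomial, mul_add, map_add] at hp hq ⊢
      rw [hp, hq]

lemma ev_elementaryHom (hI : IsMonomialIdeal I) (g : Fin 3 →₀ ℕ) (b : Fin 3 →₀ ℕ) (h)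
    (g' : {d // monomial d (1 : ℂ) ∈ I}) (b' : stdExps I) (hg : g ≤ g'.1 → g'.1 = g) :
    ev hI g' b' (elementaryHom hI g b h) = if g'.1 = g ∧ b'.1 = b then 1 else 0 := by
  change coeff b'.1 (monomial b 1 * divMonomial (monomial g'.1 1) g) = _
  by_cases hgg : g'.1 = g
  · rw [hgg, divMonomial_monomial, mul_one, coeff_monomial]
    simp [eq_comm]
  · have hne (c : Fin 3 →₀ ℕ) : g'.1 ≠ g + c := fun h' => hgg (hg (le_self_add.trans_eq h'.symm))
    simp [coeff_monomial_mul', coeff_divMonomial, coeff_monomial, hne, hgg]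

end Hom

section Lists

/-- Exponents `(i, j, k)` of the monomials `x ^ i * y ^ j * z ^ k`. -/
abbrev Expo := ℕ × ℕ × ℕ

/-- Componentwise comparison. -/
def le3 (p q : Expo) : Bool := p.1.ble q.1 && p.2.1.ble q.2.1 && p.2.2.ble q.2.2

/-- The predecessors of an exponent for the covering moves `z ↦ 1`, `y ↦ z`, `x ↦ y` lie in `l`. -/
def fits (l : List Expo) : Expo → Bool
  | (i, j, k) => (k == 0 || l.contains (i, j, k - 1)) && (j == 0 || l.contains (i, j - 1, k + 1)) &&
      (i == 0 || l.contains (i - 1, j + 1, k))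

/-- The Borel-fixed staircases obtained by adding a lexicographically last element. -/
def extensions : List Expo → List (List Expo)
  | [] => [[(0, 0, 0)]]
  | (i, j, k) :: l =>
    ([(i, j, k + 1), (i, j + 1, 0), (i + 1, 0, 0)].filter (fits ((i, j, k) :: l))).map
      (· :: (i, j, k) :: l)

/-- All Borel-fixed staircases with `n` elements, each listed in decreasing lexicographic order. -/
def borelLists : ℕ → List (List Expo)
  | 0 => [[]]
  | n + 1 => (borelLists n).flatMap extensions

/-- All divisors of an exponent obtained by lowering one coordinate by one lie in `l`. -/
def covered (l : List Expo) : Expo → Bool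
  | (i, j, k) => (k == 0 || l.contains (i, j, k - 1)) && (j == 0 || l.contains (i, j - 1, k)) &&
      (i == 0 || l.contains (i - 1, j, k))

/-- The minimal generators of the monomial ideal with standard monomials `l`. -/
def gens (l : List Expo) : List Expo :=
  ((l.flatMap fun p => [(p.1, p.2.1, p.2.2 + 1), (p.1, p.2.1 + 1, p.2.2),
    (p.1 + 1, p.2.1, p.2.2)]).filter fun p => !l.contains p && covered l p).dedup

/-- A syzygy (or a chain of at most `n` syzygies) between generators `gs` forces the coefficient
of `b` in the image of `g` to vanish. -/
def killed (l gs : List Expo) : ℕ → Expo → Expo → Bool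
  | 0, _, _ => false
  | n + 1, g, b => l.any fun t => le3 b t && gs.any fun m => le3 m (g + (t - b)) &&
      (!le3 (g + (t - b) - m) t || killed l gs n m (t - (g + (t - b) - m)))

/-- The pairs of a generator and a standard monomial that are not `killed`. -/
def freePairs (l : List Expo) : List (Expo × Expo) :=
  (gens l ×ˢ l).filter fun p => !killed l (gens l) 2 p.1 p.2

/-- No syzygy relates a free pair to any other coefficient. -/
def isRigid (l : List Expo) : Bool :=
  (gens l).all (fun g => (gens l).all fun m => !le3 g m || m == g) &&
  (freePairs l).all fun p => l.all fun t => !le3 p.2 t ||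
    (gens l).all fun m => !le3 m (p.1 + (t - p.2)) || m == p.1

/-- The exponent vector of `x ^ i * y ^ j * z ^ k`. -/
noncomputable def vec (p : Expo) : Fin 3 →₀ ℕ :=
  Finsupp.equivFunOnFinite.symm ![p.1, p.2.1, p.2.2]

@[simp] lemma vec_zero (p : Expo) : vec p 0 = p.1 := rfl
@[simp] lemma vec_one (p : Expo) : vec p 1 = p.2.1 := rfl
@[simp] lemma vec_two (p : Expo) : vec p 2 = p.2.2 := rfl

lemma vec_surjective : Function.Surjective vec := fun d =>
  ⟨(d 0, d 1, d 2), by ext i; fin_cases i <;> rfl⟩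

lemma vec_injective : Function.Injective vec := fun p q h => by
  have h0 := DFunLike.congr_fun h 0
  have h1 := DFunLike.congr_fun h 1
  have h2 := DFunLike.congr_fun h 2
  exact Prod.ext h0 (Prod.ext h1 h2)

lemma vec_add (p q : Expo) : vec (p + q) = vec p + vec q := by
  ext i; fin_cases i <;> rfl

lemma vec_sub (p q : Expo) : vec (p - q) = vec p - vec q := by
  ext i; fin_cases i <;> rfl

lemma le3_iff {p q : Expo} : le3 p q = true ↔ vec p ≤ vec q := by
  simp [le3, Finsupp.le_def, Fin.forall_fin_succ, and_assoc]

lemma vec_mono {p q : Expo} (h : p ≤ q) : vec p ≤ vec q := by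
  rw [Prod.le_def, Prod.le_def] at h
  simpa [Finsupp.le_def, Fin.forall_fin_succ] using h

variable {I : Ideal (MvPolynomial (Fin 3) ℂ)} {l : List Expo}

/-- `l` lists the standard monomials of `I`. -/
def Lists (l : List Expo) (I : Ideal (MvPolynomial (Fin 3) ℂ)) : Prop :=
  ∀ p, p ∈ l ↔ vec p ∈ stdExps I

lemma Lists.mem_ideal (hl : Lists l I) {p : Expo} (hp : p ∉ l) : monomial (vec p) (1 : ℂ) ∈ I := by
  by_contra h
  exact hp ((hl p).mpr h)

lemma notMem_of_mem_gens {g : Expo} (h : g ∈ gens l) : g ∉ l := by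
  simp only [gens, List.mem_dedup, List.mem_filter] at h
  simpa using (Bool.and_eq_true_iff.mp h.2).1

lemma exists_gens_le (hl : Lists l I) (hne : l ≠ []) :
    ∀ p, p ∉ l → ∃ g ∈ gens l, vec g ≤ vec p := by
  have h0 : (0, 0, 0) ∈ l := by
    obtain ⟨q, hq⟩ := List.exists_mem_of_ne_nil l hne
    exact (hl _).mpr (mem_stdExps_of_le (vec_mono (by simp [Prod.le_def])) ((hl q).mp hq))
  suffices H : ∀ n (p : Expo), p.1 + p.2.1 + p.2.2 = n → p ∉ l → ∃ g ∈ gens l, vec g ≤ vec p from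
    fun p => H _ p rfl
  intro n
  induction n with
  | zero =>
    rintro ⟨i, j, k⟩ hp hn
    obtain ⟨rfl, rfl, rfl⟩ : i = 0 ∧ j = 0 ∧ k = 0 := by simp at hp; omega
    exact absurd h0 hn
  | succ n ih =>
    rintro ⟨i, j, k⟩ hp hn
    simp only at hp
    have step : ∀ q : Expo, q ≤ (i, j, k) → q.1 + q.2.1 + q.2.2 = n → q ∉ l →
        ∃ g ∈ gens l, vec g ≤ vec (i, j, k) := fun q hq hqn hql => by
      obtain ⟨g, hg, hgq⟩ := ih q hqn hql
      exact ⟨g, hg, hgq.trans (vec_mono hq)⟩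
    by_cases hk : k = 0 ∨ (i, j, k - 1) ∈ l
    swap
    · push Not at hk
      exact step _ (by simp [Prod.le_def]) (by simp only; omega) hk.2
    by_cases hj : j = 0 ∨ (i, j - 1, k) ∈ l
    swap
    · push Not at hj
      exact step _ (by simp [Prod.le_def]) (by simp only; omega) hj.2
    by_cases hi : i = 0 ∨ (i - 1, j, k) ∈ l
    swap
    · push Not at hi
      exact step _ (by simp [Prod.le_def]) (by simp only; omega) hi.2
    refine ⟨(i, j, k), ?_, le_rfl⟩
    simp only [gens, List.mem_dedup, List.mem_filter, List.mem_flatMap]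
    refine ⟨?_, by simp [covered, hn, hk, hj, hi]⟩
    rcases Nat.eq_zero_or_pos k with hk0 | hk0
    · rcases Nat.eq_zero_or_pos j with hj0 | hj0
      · exact ⟨(i - 1, j, k), hi.resolve_left (by omega), by simp; omega⟩
      · exact ⟨(i, j - 1, k), hj.resolve_left (by omega), by simp; omega⟩
    · exact ⟨(i, j, k - 1), hk.resolve_left (by omega), by simp; omega⟩

lemma ev_eq_zero_of_killed (hI : IsMonomialIdeal I) (hl : Lists l I)
    (φ : ↥I →ₗ[MvPolynomial (Fin 3) ℂ] (MvPolynomial (Fin 3) ℂ ⧸ I)) :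
    ∀ (n : ℕ) (g b : Expo) (hg : monomial (vec g) (1 : ℂ) ∈ I) (hb : vec b ∈ stdExps I),
      killed l (gens l) n g b = true → ev hI ⟨_, hg⟩ ⟨_, hb⟩ φ = 0 := by
  intro n
  induction n with
  | zero => simp [killed]
  | succ n ih =>
    intro g b hg hb h
    simp only [killed, List.any_eq_true, Bool.and_eq_true, Bool.or_eq_true, Bool.not_eq_true',
      ← Bool.not_eq_true, le3_iff, vec_sub, vec_add] at h
    obtain ⟨t, ht, hbt, m, hm, hmg, h⟩ := h
    have hmI := hl.mem_ideal (notMem_of_mem_gens hm)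
    rw [ev_eq_coeffQ hI ⟨_, hg⟩ ⟨_, hmI⟩ ⟨_, hb⟩ ⟨_, (hl t).mp ht⟩ hbt hmg]
    by_cases he : vec g + (vec t - vec b) - vec m ≤ vec t
    · have hk := h.resolve_left (not_not.mpr he)
      have hb' : vec (t - (g + (t - b) - m)) ∈ stdExps I :=
        mem_stdExps_of_le (vec_mono tsub_le_self) ((hl t).mp ht)
      rw [coeffQ_monomial_smul hI _ he, ← ih m _ hmI hb' hk]
      simp only [vec_sub, vec_add]
      rfl
    · exact coeffQ_monomial_smul_of_not_le hI _ he _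

lemma mem_freePairs {x : Expo × Expo} : x ∈ freePairs l ↔
    (x.1 ∈ gens l ∧ x.2 ∈ l) ∧ killed l (gens l) 2 x.1 x.2 = false := by
  obtain ⟨g, b⟩ := x
  simp [freePairs]

/-- The coefficients of a tangent vector at the free pairs. -/
noncomputable def freeCoeffs (hI : IsMonomialIdeal I) (hl : Lists l I) :
    (↥I →ₗ[MvPolynomial (Fin 3) ℂ] (MvPolynomial (Fin 3) ℂ ⧸ I)) →ₗ[ℂ]
      ((freePairs l).toFinset → ℂ) :=
  LinearMap.pi fun x =>
    have hx := (mem_freePairs.mp (List.mem_toFinset.mp x.2)).1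
    ev hI ⟨vec x.1.1, hl.mem_ideal (notMem_of_mem_gens hx.1)⟩ ⟨vec x.1.2, (hl _).mp hx.2⟩

lemma freeCoeffs_injective (hI : IsMonomialIdeal I) (hl : Lists l I) (hne : l ≠ []) :
    Function.Injective (freeCoeffs hI hl) := by
  rw [injective_iff_map_eq_zero]
  intro φ hφ
  refine eq_zero_of_ev hI {g | ∃ q ∈ gens l, g.1 = vec q} ?_ φ ?_
  · intro d hd
    obtain ⟨p, rfl⟩ := vec_surjective d
    obtain ⟨g, hg, hgp⟩ := exists_gens_le hl hne p fun h => (hl p).mp h hd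
    exact ⟨⟨vec g, hl.mem_ideal (notMem_of_mem_gens hg)⟩, ⟨g, hg, rfl⟩, hgp⟩
  · rintro ⟨g, hgI⟩ ⟨q, hq, rfl⟩ ⟨b, hb⟩
    obtain ⟨b, rfl⟩ := vec_surjective b
    by_cases hk : killed l (gens l) 2 q b = true
    · exact ev_eq_zero_of_killed hI hl φ 2 q b hgI hb hk
    · have hx : (q, b) ∈ freePairs l :=
        mem_freePairs.mpr ⟨⟨hq, (hl b).mpr hb⟩, Bool.eq_false_of_not_eq_true hk⟩
      exact congrFun hφ ⟨(q, b), List.mem_toFinset.mpr hx⟩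

lemma tangentDim_le (hI : IsMonomialIdeal I) (hl : Lists l I) (hne : l ≠ []) :
    tangentDim I ≤ (freePairs l).length := by
  refine (LinearMap.finrank_le_finrank_of_injective (freeCoeffs_injective hI hl hne)).trans ?_
  rw [Module.finrank_fintype_fun_eq_card, Fintype.card_coe]
  exact List.toFinset_card_le _

lemma tangentDim_eq (hI : IsMonomialIdeal I) (hl : Lists l I) (hne : l ≠ [])
    (hr : isRigid l = true) : tangentDim I = (freePairs l).toFinset.card := by
  simp only [isRigid, Bool.and_eq_true, List.all_eq_true, Bool.or_eq_true, Bool.not_eq_true',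
    ← Bool.not_eq_true, le3_iff, beq_iff_eq, vec_add, vec_sub] at hr
  obtain ⟨hanti, hrig⟩ := hr
  have hhom : ∀ x ∈ freePairs l, ∀ t ∈ stdExps I, vec x.2 ≤ t → ∀ m, monomial m (1 : ℂ) ∈ I →
      m ≤ vec x.1 + (t - vec x.2) → vec x.1 ≤ m := by
    intro x hx t ht hbt m hm hmg
    obtain ⟨t, rfl⟩ := vec_surjective t
    obtain ⟨m, rfl⟩ := vec_surjective m
    obtain ⟨g, hg, hgm⟩ := exists_gens_le hl hne m fun h => (hl m).mp h hm
    have := ((hrig x hx t ((hl t).mpr ht)).resolve_left (not_not.mpr hbt) g hg).resolve_left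
      (not_not.mpr (hgm.trans hmg))
    exact this ▸ hgm
  have hsurj : Function.Surjective (freeCoeffs hI hl) := by
    rw [← LinearMap.range_eq_top, eq_top_iff, ← (Pi.basisFun ℂ _).span_eq, Submodule.span_le]
    rintro _ ⟨x, rfl⟩
    have hx := List.mem_toFinset.mp x.2
    refine ⟨elementaryHom hI (vec x.1.1) (vec x.1.2) (hhom x.1 hx), ?_⟩
    ext y
    have hy := (mem_freePairs.mp (List.mem_toFinset.mp y.2)).1
    have hx1 := (mem_freePairs.mp hx).1.1
    refine (ev_elementaryHom hI _ _ (hhom x.1 hx) _ _ fun hle => congrArg vec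
      ((hanti _ hx1 _ hy.1).resolve_left (not_not.mpr hle))).trans ?_
    simp only [vec_injective.eq_iff, Pi.basisFun_apply, Pi.single_apply, Subtype.ext_iff,
      Prod.ext_iff]
  rw [← Fintype.card_coe, ← Module.finrank_fintype_fun_eq_card ℂ]
  exact (LinearEquiv.ofBijective _ ⟨freeCoeffs_injective hI hl hne, hsurj⟩).finrank_eq

end Lists

section Enumeration

/-- Closure of a staircase under the moves `z ↦ 1`, `y ↦ z`, `x ↦ y`. -/
def IsBorelSet (S : Set Expo) : Prop :=
  ∀ i j k, ((i, j, k + 1) ∈ S → (i, j, k) ∈ S) ∧ ((i, j + 1, k) ∈ S → (i, j, k + 1) ∈ S) ∧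
    ((i + 1, j, k) ∈ S → (i, j + 1, k) ∈ S)

/-- Strict lexicographic order. -/
def LexLt (p q : Expo) : Prop :=
  p.1 < q.1 ∨ p.1 = q.1 ∧ (p.2.1 < q.2.1 ∨ p.2.1 = q.2.1 ∧ p.2.2 < q.2.2)

lemma exists_lexLast {S : Finset Expo} (hS : S.Nonempty) :
    ∃ p ∈ S, ∀ q ∈ S, q ≠ p → LexLt q p := by
  obtain ⟨p, hp, h⟩ := S.exists_max_image (fun p => toLex (p.1, toLex (p.2.1, p.2.2))) hS
  refine ⟨p, hp, fun q hq hne => ?_⟩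
  have := h q hq
  simp only [Prod.Lex.le_iff, ofLex_toLex] at this
  have hne' : ¬ (q.1 = p.1 ∧ q.2.1 = p.2.1 ∧ q.2.2 = p.2.2) := by
    rwa [← Prod.ext_iff.trans (and_congr_right' Prod.ext_iff)]
  unfold LexLt
  omega

lemma exists_mem_borelLists : ∀ (n : ℕ) (S : Finset Expo), IsBorelSet (S : Set Expo) →
    S.card = n → ∃ l ∈ borelLists n, (∀ p, p ∈ l ↔ p ∈ S) ∧ l.Pairwise fun p q => LexLt q p := by
  intro n
  induction n with
  | zero =>
    intro S _ hS
    refine ⟨[], by simp [borelLists], by simp [Finset.card_eq_zero.mp hS], List.Pairwise.nil⟩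
  | succ n ih =>
    intro S hB hS
    obtain ⟨⟨i, j, k⟩, hp, hlast⟩ := exists_lexLast (Finset.card_pos.mp (by omega : 0 < S.card))
    have hB' : IsBorelSet (S.erase (i, j, k) : Set Expo) := by
      intro a b c
      simp only [Finset.coe_erase, Set.mem_sdiff, Finset.mem_coe, Set.mem_singleton_iff]
      have hb := hB a b c
      simp only [Finset.mem_coe] at hb
      refine ⟨fun h => ⟨hb.1 h.1, ?_⟩, fun h => ⟨hb.2.1 h.1, ?_⟩, fun h => ⟨hb.2.2 h.1, ?_⟩⟩ <;>
      · rintro he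
        have := hlast _ h.1 h.2
        rw [← he] at this
        simp only [LexLt] at this
        omega
    obtain ⟨l, hl, hmem, hsort⟩ := ih _ hB' (by rw [Finset.card_erase_of_mem hp, hS]; rfl)
    have hmem' : ∀ q, q ∈ l ↔ q ≠ (i, j, k) ∧ q ∈ S := fun q => by rw [hmem, Finset.mem_erase]
    refine ⟨(i, j, k) :: l, ?_, fun q => ?_, List.pairwise_cons.mpr ⟨fun q hq => ?_, hsort⟩⟩
    · refine List.mem_flatMap.mpr ⟨l, hl, ?_⟩
      have hz : k ≠ 0 → (i, j, k - 1) ∈ l := fun h => by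
        obtain ⟨k, rfl⟩ := Nat.exists_eq_succ_of_ne_zero h
        exact (hmem' _).mpr ⟨by simp, (hB i j k).1 hp⟩
      have hy : j ≠ 0 → (i, j - 1, k + 1) ∈ l := fun h => by
        obtain ⟨j, rfl⟩ := Nat.exists_eq_succ_of_ne_zero h
        exact (hmem' _).mpr ⟨by simp, (hB i j k).2.1 hp⟩
      have hx : i ≠ 0 → (i - 1, j + 1, k) ∈ l := fun h => by
        obtain ⟨i, rfl⟩ := Nat.exists_eq_succ_of_ne_zero h
        exact (hmem' _).mpr ⟨by simp, (hB i j k).2.2 hp⟩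
      have hfits : fits l (i, j, k) = true := by
        simp only [fits, List.contains_iff_mem, Bool.and_eq_true, Bool.or_eq_true, beq_iff_eq]
        exact ⟨⟨or_iff_not_imp_left.mpr hz, or_iff_not_imp_left.mpr hy⟩,
          or_iff_not_imp_left.mpr hx⟩
      match l, hsort with
      | [], _ =>
        have hk : k = 0 := by by_contra h; simpa using hz h
        have hj : j = 0 := by by_contra h; simpa using hy h
        have hi : i = 0 := by by_contra h; simpa using hx h
        simp [extensions, hi, hj, hk]
      | (a, b, c) :: l, hsort =>
        have hhead := (hmem' (a, b, c)).mp (by simp)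
        have hlt := hlast _ hhead.2 hhead.1
        have hle : ∀ q ∈ (a, b, c) :: l, q = (a, b, c) ∨ LexLt q (a, b, c) := fun q hq =>
          (List.mem_cons.mp hq).imp_right ((List.pairwise_cons.mp hsort).1 q)
        simp only [extensions, List.mem_map, List.mem_filter]
        refine ⟨_, ⟨?_, hfits⟩, rfl⟩
        simp only [LexLt] at hle hlt
        simp only [List.mem_cons, Prod.mk.injEq, List.not_mem_nil, or_false]
        rcases eq_or_ne k 0 with hk | hk
        · rcases eq_or_ne j 0 with hj | hj
          · rcases eq_or_ne i 0 with hi | hi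
            · omega
            · have := hle _ (hx hi)
              simp only [Prod.mk.injEq] at this
              omega
          · have := hle _ (hy hj)
            simp only [Prod.mk.injEq] at this
            omega
        · have := hle _ (hz hk)
          simp only [Prod.mk.injEq] at this
          omega
    · rw [List.mem_cons, hmem']
      by_cases hq : q = (i, j, k) <;> simp [hq, hp]
    · exact hlast q ((hmem' q).mp hq).2 ((hmem' q).mp hq).1

variable {I : Ideal (MvPolynomial (Fin 3) ℂ)}

lemma isBorelSet_stdExps (hB : IsBorelFixed I) : IsBorelSet (vec ⁻¹' stdExps I) := by
  intro i j k
  refine ⟨fun h => mem_stdExps_of_le (vec_mono (by simp [Prod.le_def])) h,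
    fun h hI => h ?_, fun h hI => h ?_⟩
  · have : vec (i, j + 1, k) = vec (i, j, k + 1) + Finsupp.single 1 1 - Finsupp.single 2 1 := by
      ext a
      fin_cases a <;> simp
    exact this ▸ hB _ hI 1 2 (by decide) (by simp)
  · have : vec (i + 1, j, k) = vec (i, j + 1, k) + Finsupp.single 0 1 - Finsupp.single 1 1 := by
      ext a
      fin_cases a <;> simp
    exact this ▸ hB _ hI 0 1 (by decide) (by simp)

lemma exists_borelList (hI : IsMonomialIdeal I) (hB : IsBorelFixed I) {n : ℕ} (hn : n ≠ 0)
    (h : Module.finrank ℂ (MvPolynomial (Fin 3) ℂ ⧸ I) = n) : ∃ l ∈ borelLists n, Lists l I := by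
  have hcard : (vec ⁻¹' stdExps I).ncard = n := by
    rw [Set.ncard_preimage_of_injective_subset_range vec_injective
      (by simp [vec_surjective.range_eq]), ← finrank_quotient hI, h]
  have hfin : (vec ⁻¹' stdExps I).Finite := Set.finite_of_ncard_ne_zero (hcard ▸ hn)
  obtain ⟨l, hl, hmem, -⟩ := exists_mem_borelLists n hfin.toFinset
    (by simpa using isBorelSet_stdExps hB) (by rw [← hcard, Set.ncard_eq_toFinset_card _ hfin])
  exact ⟨l, hl, fun p => by simp [hmem]⟩

end Enumeration

section Construction

variable {l : List Expo}

lemma IsBorelSet.of_le {S : Set Expo} (hS : IsBorelSet S) {p q : Expo} (h : vec p ≤ vec q)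
    (hq : q ∈ S) : p ∈ S := by
  obtain ⟨i, j, k⟩ := p
  obtain ⟨i', j', k'⟩ := q
  have h0 := h 0
  have h1 := h 1
  have h2 := h 2
  simp only [vec_zero, vec_one, vec_two] at h0 h1 h2
  have hz : ∀ n a b c, (a, b, c + n) ∈ S → (a, b, c) ∈ S := fun n => by
    induction n with
    | zero => exact fun _ _ _ h => h
    | succ n ih => exact fun a b c h => ih a b c ((hS a b (c + n)).1 h)
  have hy : ∀ n a b c, (a, b + n, c) ∈ S → (a, b, c) ∈ S := fun n => by
    induction n with
    | zero => exact fun _ _ _ h => h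
    | succ n ih => exact fun a b c h => ih a b c (hz 1 _ _ _ ((hS a (b + n) c).2.1 h))
  have hx : ∀ n a b c, (a + n, b, c) ∈ S → (a, b, c) ∈ S := fun n => by
    induction n with
    | zero => exact fun _ _ _ h => h
    | succ n ih => exact fun a b c h => ih a b c (hy 1 _ _ _ ((hS (a + n) b c).2.2 h))
  obtain ⟨a, rfl⟩ := Nat.exists_eq_add_of_le h0
  obtain ⟨b, rfl⟩ := Nat.exists_eq_add_of_le h1
  obtain ⟨c, rfl⟩ := Nat.exists_eq_add_of_le h2
  exact hx a _ _ _ (hy b _ _ _ (hz c _ _ _ hq))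

lemma isBorelSet_of_fits (h : l.all (fits l) = true) : IsBorelSet {p | p ∈ l} := by
  intro i j k
  simp only [List.all_eq_true] at h
  refine ⟨fun hp => ?_, fun hp => ?_, fun hp => ?_⟩ <;>
  · have := h _ hp
    simp [fits] at this
    simp [this]

/-- A finite Borel-fixed staircase is the set of standard monomials of a Borel-fixed ideal. -/
lemma exists_ideal (hS : IsBorelSet {p | p ∈ l}) (hl : l.Nodup) :
    ∃ I : Ideal (MvPolynomial (Fin 3) ℂ), IsMonomialIdeal I ∧ IsBorelFixed I ∧
      Module.finrank ℂ (MvPolynomial (Fin 3) ℂ ⧸ I) = l.length ∧ Lists l I := by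
  have hup : IsUpperSet (vec '' {p | p ∈ l})ᶜ := by
    rintro d e hde hd ⟨q, hq, rfl⟩
    obtain ⟨p, rfl⟩ := vec_surjective d
    exact hd ⟨p, hS.of_le hde hq, rfl⟩
  have hmem : ∀ f, f ∈ restrictSupportIdeal (R := ℂ) _ hup ↔
      ∀ d ∈ f.support, d ∈ (vec '' {p | p ∈ l})ᶜ := fun f => Iff.rfl
  have hmon : ∀ p : Expo, monomial (vec p) (1 : ℂ) ∈ restrictSupportIdeal (R := ℂ) _ hup ↔
      p ∉ l := fun p => by
    rw [hmem, support_monomial, if_neg one_ne_zero]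
    simp only [Finset.mem_singleton, forall_eq, Set.mem_compl_iff, vec_injective.mem_set_image,
      Set.mem_ofPred_eq]
  have hlists : Lists l (restrictSupportIdeal (R := ℂ) _ hup) := fun p => by
    simp [stdExps, hmon]
  have hI : IsMonomialIdeal (restrictSupportIdeal (R := ℂ) _ hup) := by
    intro f hf d hd
    obtain ⟨p, rfl⟩ := vec_surjective d
    exact (hmon p).mpr fun hp => (hmem f).mp hf _ hd ⟨p, hp, rfl⟩
  refine ⟨_, hI, ?_, ?_, hlists⟩
  · intro d hd a b hab hpos
    obtain ⟨⟨i, j, k⟩, rfl⟩ := vec_surjective d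
    rw [hmon] at hd
    have hyz : ∀ i j k, (i, j + 1, k) ∈ l → (i, j, k + 1) ∈ l := fun i j k => (hS i j k).2.1
    have hxy : ∀ i j k, (i + 1, j, k) ∈ l → (i, j + 1, k) ∈ l := fun i j k => (hS i j k).2.2
    have key : ∀ q : Expo, vec q = vec (i, j, k) + Finsupp.single a 1 - Finsupp.single b 1 →
        q ∉ l → monomial (vec (i, j, k) + Finsupp.single a 1 - Finsupp.single b 1) (1 : ℂ) ∈
          restrictSupportIdeal (R := ℂ) _ hup := fun q h hq => h ▸ (hmon q).mpr hq
    fin_cases a <;> fin_cases b <;> simp at hab hpos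
    · obtain ⟨j, rfl⟩ := Nat.exists_eq_succ_of_ne_zero hpos.ne'
      exact key (i + 1, j, k) (by ext a; fin_cases a <;> simp) fun h => hd (hxy _ _ _ h)
    · obtain ⟨k, rfl⟩ := Nat.exists_eq_succ_of_ne_zero hpos.ne'
      exact key (i + 1, j, k) (by ext a; fin_cases a <;> simp)
        fun h => hd (hyz _ _ _ (hxy _ _ _ h))
    · obtain ⟨k, rfl⟩ := Nat.exists_eq_succ_of_ne_zero hpos.ne'
      exact key (i, j + 1, k) (by ext a; fin_cases a <;> simp) fun h => hd (hyz _ _ _ h)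
  · rw [finrank_quotient hI, show stdExps _ = vec '' {p | p ∈ l} from ?_,
      Set.ncard_image_of_injective _ vec_injective, ← List.coe_toFinset, Set.ncard_coe_finset,
      List.toFinset_card_of_nodup hl]
    ext d
    obtain ⟨p, rfl⟩ := vec_surjective d
    rw [← hlists p]
    simp [vec_injective.eq_iff]

end Construction

section ColengthTen

lemma X_pow_mem_iff {I : Ideal (MvPolynomial (Fin 3) ℂ)} {l : List Expo} (hl : Lists l I)
    (n : ℕ) : (X 0 : MvPolynomial (Fin 3) ℂ) ^ n ∈ I ↔ (n, 0, 0) ∉ l := by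
  have : vec (n, 0, 0) = Finsupp.single 0 n := by
    ext a
    fin_cases a <;> simp
  rw [hl, X_pow_eq_monomial, ← this]
  exact not_not.symm

/-- The claimed bound on the tangent dimension, by the power of `x` in the ideal. -/
def dimBound (l : List Expo) : ℕ :=
  if l.contains (2, 0, 0) then 60 else if l.contains (1, 0, 0) then 46 else 45

lemma freePairs_length_le : ∀ l ∈ borelLists 10, l ≠ [] ∧ (freePairs l).length ≤ dimBound l := by
  decide +kernel

lemma tangentDim_le_dimBound {I : Ideal (MvPolynomial (Fin 3) ℂ)} (hI : IsMonomialIdeal I)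
    (hB : IsBorelFixed I) (h : Module.finrank ℂ (MvPolynomial (Fin 3) ℂ ⧸ I) = 10) :
    ∃ l, Lists l I ∧ tangentDim I ≤ dimBound l := by
  obtain ⟨l, hmem, hl⟩ := exists_borelList hI hB (by norm_num) h
  obtain ⟨hne, hle⟩ := freePairs_length_le l hmem
  exact ⟨l, hl, (tangentDim_le hI hl hne).trans hle⟩

lemma TmaxEq_ten {m T : ℕ} (l : List Expo) (hlen : l.length = 10) (hnd : l.Nodup)
    (hfits : l.all (fits l) = true) (hm : (m, 0, 0) ∉ l) (hm' : (m - 1, 0, 0) ∈ l)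
    (hr : isRigid l = true) (hT : (freePairs l).toFinset.card = T)
    (hub : ∀ l : List Expo, (m, 0, 0) ∉ l → (m - 1, 0, 0) ∈ l → dimBound l ≤ T) :
    TmaxEq 10 m T := by
  constructor
  · obtain ⟨I, hI, hB, hfin, hl⟩ := exists_ideal (isBorelSet_of_fits hfits) hnd
    refine ⟨I, hI, hB, hfin.trans hlen, (X_pow_mem_iff hl m).mpr hm, ?_, ?_⟩
    · rwa [X_pow_mem_iff hl, not_not]
    · rw [tangentDim_eq hI hl (List.ne_nil_of_mem hm') hr, hT]
  · rintro _ ⟨I, hI, hB, hfin, h1, h2, rfl⟩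
    obtain ⟨l, hl, hle⟩ := tangentDim_le_dimBound hI hB hfin
    rw [X_pow_mem_iff hl] at h1 h2
    exact hle.trans (hub l h1 (not_not.mp h2))

end ColengthTen

end BorelTangent

open BorelTangent in
theorem Tmax_monotonicity_l10 :
    TmaxEq 10 2 46 ∧
    TmaxEq 10 3 60 ∧
    (∀ T1 T2 T3 : ℕ, TmaxEq 10 1 T1 → TmaxEq 10 2 T2 → TmaxEq 10 3 T3 →
      T1 < T2 ∧ T2 < T3) := by
  have h2 : TmaxEq 10 2 46 := by
    refine TmaxEq_ten [(0, 0, 0), (0, 0, 1), (0, 0, 2), (0, 0, 3), (0, 1, 0), (0, 1, 1),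
      (0, 2, 0), (1, 0, 0), (1, 0, 1), (1, 1, 0)] rfl (by decide) (by decide) (by decide)
      (by decide) (by decide +kernel) (by decide +kernel) fun l h _ => ?_
    rw [dimBound, if_neg (by simpa using h)]
    split_ifs <;> norm_num
  have h3 : TmaxEq 10 3 60 := by
    refine TmaxEq_ten [(0, 0, 0), (0, 0, 1), (0, 0, 2), (0, 1, 0), (0, 1, 1), (0, 2, 0),
      (1, 0, 0), (1, 0, 1), (1, 1, 0), (2, 0, 0)] rfl (by decide) (by decide) (by decide)
      (by decide) (by decide +kernel) (by decide +kernel) fun l _ _ => ?_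
    unfold dimBound
    split_ifs <;> norm_num
  refine ⟨h2, h3, fun T1 T2 T3 hT1 hT2 hT3 => ?_⟩
  rw [hT2.unique h2, hT3.unique h3]
  obtain ⟨I, hI, hB, hfin, hx, -, rfl⟩ := hT1.1
  obtain ⟨l, hl, hle⟩ := tangentDim_le_dimBound hI hB hfin
  have hx2 : (2, 0, 0) ∉ l := (X_pow_mem_iff hl 2).mp <| by
    rw [pow_two]
    exact I.mul_mem_left _ (pow_one (X 0 : MvPolynomial (Fin 3) ℂ) ▸ hx)
  rw [X_pow_mem_iff hl] at hx
  rw [dimBound, if_neg (by simpa using hx2), if_neg (by simpa using hx)] at hle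
  omega
end

section
/- T_{max,2}(11) = 49 and T_{max,3}(11) = 63; in particular, for l = 11 the function m1 ↦ T_{max,m1}(11) is strictly increasing on {1, 2, 3}. -/
open MvPolynomial

/-- Exponent vectors of monomials in `x, y, z`. -/
abbrev Exponent := ℕ × ℕ × ℕ

/-- The exponents of the three variables. -/
def unitExponents : List Exponent := [(1, 0, 0), (0, 1, 0), (0, 0, 1)]

/-- Componentwise comparison of exponents. -/
def divides (d e : Exponent) : Bool := d.1.ble e.1 && (d.2.1.ble e.2.1 && d.2.2.ble e.2.2)

/-- `x^i y^j z^k` lies under the staircase with column heights `h`. -/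
def isStd (h : ℕ → ℕ → ℕ) (d : Exponent) : Bool := Nat.blt d.2.2 (h d.1 d.2.1)

/-- The monomials under a staircase supported on three rows and four columns. -/
def stdList (h : ℕ → ℕ → ℕ) : List Exponent :=
  (List.range 3).flatMap fun i => (List.range 4).flatMap fun j =>
    (List.range (h i j)).map fun k => (i, j, k)

/-- The candidates for the minimal monomials outside such a staircase. -/
def genList (h : ℕ → ℕ → ℕ) : List Exponent :=
  (List.range 4).flatMap fun i => (List.range 5).flatMap fun j =>
    if (Nat.beq i 0 || Nat.blt (h i j) (h (i - 1) j)) &&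
        (Nat.beq j 0 || Nat.blt (h i j) (h i (j - 1))) then [(i, j, h i j)] else []

/-- No relation coming from the syzygy of `g` with an `earlier` generator involves the coefficient
of `s` in the image of `g`, and no syzygy with a `later` one forces this coefficient to vanish. -/
def isFree (h : ℕ → ℕ → ℕ) (earlier later : List Exponent) (g s : Exponent) : Bool :=
  (earlier.all fun q => !isStd h (s + (q - g))) &&
    later.all fun q => !isStd h (s + (q - g)) || divides (g - q) s

/-- The coefficients that determine a homomorphism on the generators `gs`, given its values on the
generators `earlier`. -/
def freePairs (h : ℕ → ℕ → ℕ) (S : List Exponent) :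
    List Exponent → List Exponent → List (Exponent × Exponent)
  | _, [] => []
  | earlier, g :: gs =>
    (S.filter (isFree h earlier gs g)).map (fun s => (g, s)) ++ freePairs h S (g :: earlier) gs

/-- Coefficients that determine a homomorphism from the ideal above the staircase `h`. -/
def coordinates (h : ℕ → ℕ → ℕ) : List (Exponent × Exponent) :=
  freePairs h (stdList h) [] (genList h)

/-- `C` is a bounded connected component of the staircase `h` intersected with its complement
translated by `s - g`, and it contains `s`. -/
def isComponent (h : ℕ → ℕ → ℕ) (g s : Exponent) (C : List Exponent) : Bool :=
  !isStd h g && (C.contains s && C.all fun n =>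
    isStd h n && (divides s (n + g) && unitExponents.all fun e =>
      (!isStd h (n + e) || C.contains (n + e)) &&
      (!divides e (n + g - s) || isStd h (n + g - s - e) ||
        (divides e n && C.contains (n - e)))))

/-- One step of the search for the component containing the list `C`. -/
def grow (h : ℕ → ℕ → ℕ) (g s : Exponent) (C : List Exponent) : List Exponent :=
  C ++ C.flatMap fun n => unitExponents.flatMap fun e =>
    (if isStd h (n + e) then [n + e] else []) ++
    (if divides e (n + g - s) && (!isStd h (n + g - s - e) && divides e n) then [n - e] else [])

/-- The part of the component of `s` reached in two steps. -/
def component (h : ℕ → ℕ → ℕ) (p : Exponent × Exponent) : List Exponent :=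
  grow h p.1 p.2 (grow h p.1 p.2 [p.2])

/-- The coefficient at `p` of the homomorphism given by the component of `q` does not vanish. -/
def meets (h : ℕ → ℕ → ℕ) (p q : Exponent × Exponent) : Bool :=
  decide (p.1 + q.2 = p.2 + q.1) && (component h q).contains p.2

/-- The coordinates are independent. -/
def independentCheck (h : ℕ → ℕ → ℕ) : Bool :=
  (coordinates h).all (fun p => isComponent h p.1 p.2 (component h p)) &&
    decide ((coordinates h).Pairwise fun p q => !meets h p q && !meets h q p)

/-- The staircase with the given rows of column heights. -/
def table (rows : List (List ℕ)) (i j : ℕ) : ℕ := (rows.getD i []).getD j 0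

/-- The number of coordinates of a staircase with these column heights is within the asserted
maximum. -/
abbrev HasBound (a0 a1 a2 a3 b0 b1 b2 c0 : ℕ) : Prop :=
  (coordinates (table [[a0, a1, a2, a3], [b0, b1, b2], [c0]])).length ≤
    if c0 = 0 then if b0 = 0 then 48 else 49 else 63

/-- The bound for all strongly stable staircases of size eleven with given first row. -/
abbrev RowHasBound (a0 a1 a2 a3 : ℕ) : Prop :=
  ∀ b0 ∈ List.range 12, b0 ≤ a1 → ∀ b1 ∈ List.range 12, b1 ≤ a2 ∧ (b1 = 0 ∨ b1 < b0) →
  ∀ b2 ∈ List.range 12, b2 ≤ a3 ∧ (b2 = 0 ∨ b2 < b1) →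
  ∀ c0 ∈ List.range 12, c0 ≤ b1 ∧ a0 + a1 + a2 + a3 + b0 + b1 + b2 + c0 = 11 →
    HasBound a0 a1 a2 a3 b0 b1 b2 c0

theorem rowHasBound :
    ∀ a0 ∈ List.range 12, ∀ a1 ∈ List.range 12, (a1 = 0 ∨ a1 < a0) →
    ∀ a2 ∈ List.range 12, (a2 = 0 ∨ a2 < a1) →
    ∀ a3 ∈ List.range 12, (a3 = 0 ∨ a3 < a2) ∧ a0 + a1 + a2 + a3 ≤ 11 →
    RowHasBound a0 a1 a2 a3 := by
  decide +kernel

theorem length_coordinates_of_two_rows :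
    (coordinates (table [[4, 3, 1, 0], [2, 1, 0], [0]])).length = 49 := by
  decide +kernel

theorem length_coordinates_of_three_rows :
    (coordinates (table [[4, 2, 1, 0], [2, 1, 0], [1]])).length = 63 := by
  decide +kernel

theorem independentCheck_of_two_rows :
    independentCheck (table [[4, 3, 1, 0], [2, 1, 0], [0]]) = true := by
  decide +kernel

theorem independentCheck_of_three_rows :
    independentCheck (table [[4, 2, 1, 0], [2, 1, 0], [1]]) = true := by
  decide +kernel

/-- An exponent as a finitely supported function. -/
noncomputable def toFinsupp (d : Exponent) : Fin 3 →₀ ℕ :=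
  Finsupp.equivFunOnFinite.symm ![d.1, d.2.1, d.2.2]

theorem toFinsupp_apply (d : Fin 3 →₀ ℕ) : toFinsupp (d 0, d 1, d 2) = d := by
  ext i
  fin_cases i <;> rfl

theorem toFinsupp_add (d e : Exponent) : toFinsupp (d + e) = toFinsupp d + toFinsupp e := by
  ext i
  fin_cases i <;> rfl

theorem toFinsupp_sub (d e : Exponent) : toFinsupp (d - e) = toFinsupp d - toFinsupp e := by
  ext i
  fin_cases i <;> rfl

theorem toFinsupp_le (d e : Exponent) : toFinsupp d ≤ toFinsupp e ↔ d ≤ e := by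
  simp [toFinsupp, Finsupp.le_def, Prod.le_def, Fin.forall_fin_succ]

theorem toFinsupp_inj (d e : Exponent) : toFinsupp d = toFinsupp e ↔ d = e := by
  rw [le_antisymm_iff, toFinsupp_le, toFinsupp_le, ← le_antisymm_iff]

/-- The monomial with exponent `d`. -/
noncomputable def xm (d : Exponent) : MvPolynomial (Fin 3) ℂ :=
  monomial (toFinsupp d) 1

/-- The coefficient of the monomial with exponent `d`. -/
noncomputable def exponentCoeff (d : Exponent) : MvPolynomial (Fin 3) ℂ →ₗ[ℂ] ℂ :=
  lcoeff ℂ (toFinsupp d)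

theorem monomial_eq_xm (d : Fin 3 →₀ ℕ) : monomial d (1 : ℂ) = xm (d 0, d 1, d 2) := by
  rw [xm, toFinsupp_apply]

theorem xm_mul (d e : Exponent) : xm d * xm e = xm (d + e) := by
  rw [xm, xm, monomial_mul, one_mul, ← toFinsupp_add, xm]

theorem exponentCoeff_xm (d e : Exponent) :
    exponentCoeff d (xm e) = if e = d then 1 else 0 := by
  unfold exponentCoeff xm
  simp only [lcoeff_apply, coeff_monomial, toFinsupp_inj]

theorem divides_iff (d e : Exponent) : divides d e = true ↔ d ≤ e := by
  simp [divides, Prod.le_def]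

theorem span_xm : Submodule.span ℂ (Set.range xm) = ⊤ := by
  rw [eq_top_iff, ← (basisMonomials (Fin 3) ℂ).span_eq, Submodule.span_le]
  rintro _ ⟨d, rfl⟩
  rw [coe_basisMonomials]
  change monomial d 1 ∈ _
  rw [monomial_eq_xm]
  exact Submodule.subset_span ⟨_, rfl⟩

theorem mem_iff_forall_exponentCoeff {I : Ideal (MvPolynomial (Fin 3) ℂ)}
    (hI : IsMonomialIdeal I) (p : MvPolynomial (Fin 3) ℂ) :
    p ∈ I ↔ ∀ d, exponentCoeff d p ≠ 0 → xm d ∈ I := by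
  constructor
  · intro hp d hd
    exact hI p hp _ (mem_support_iff.2 hd)
  · intro h
    rw [← support_sum_monomial_coeff p]
    refine I.sum_mem fun d hd => ?_
    have hx : monomial d (1 : ℂ) ∈ I := by
      rw [monomial_eq_xm]
      refine h _ ?_
      rw [exponentCoeff, lcoeff_apply, toFinsupp_apply]
      exact mem_support_iff.1 hd
    have := I.mul_mem_left (C (coeff d p)) hx
    rwa [C_mul_monomial, mul_one] at this

/-- A monomial ideal is the complex span of its monomials. -/
theorem mem_span_xm {I : Ideal (MvPolynomial (Fin 3) ℂ)}
    (hI : IsMonomialIdeal I) {p : MvPolynomial (Fin 3) ℂ} (hp : p ∈ I) :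
    p ∈ Submodule.span ℂ (xm '' {d | xm d ∈ I}) := by
  rw [← support_sum_monomial_coeff p]
  refine Submodule.sum_mem _ fun d hd => ?_
  have : monomial d (coeff d p) = coeff d p • xm (d 0, d 1, d 2) := by
    rw [← monomial_eq_xm, smul_monomial, smul_eq_mul, mul_one]
  rw [this]
  refine Submodule.smul_mem _ _ (Submodule.subset_span ⟨_, ?_, rfl⟩)
  rw [Set.mem_ofPred_eq, ← monomial_eq_xm]
  exact hI p hp d hd

open Classical in
/-- The coefficient of a standard monomial, as a functional on the quotient. -/
noncomputable def quotientCoeff {I : Ideal (MvPolynomial (Fin 3) ℂ)} (hI : IsMonomialIdeal I)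
    (d : Exponent) : (MvPolynomial (Fin 3) ℂ ⧸ I) →ₗ[ℂ] ℂ :=
  (Submodule.liftQ (I.restrictScalars ℂ) (if xm d ∈ I then 0 else exponentCoeff d) (by
    intro p hp
    split_ifs with h
    · rfl
    · by_contra hne
      exact h ((mem_iff_forall_exponentCoeff hI p).1 hp d hne))).comp
    (Submodule.Quotient.restrictScalarsEquiv ℂ I).symm.toLinearMap

theorem quotientCoeff_mk {I : Ideal (MvPolynomial (Fin 3) ℂ)} (hI : IsMonomialIdeal I)
    {d : Exponent} (hd : xm d ∉ I) (p : MvPolynomial (Fin 3) ℂ) :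
    quotientCoeff hI d (Ideal.Quotient.mk I p) = exponentCoeff d p := by
  classical
  change (if xm d ∈ I then (0 : _ →ₗ[ℂ] ℂ) else exponentCoeff d) p = _
  rw [if_neg hd]

theorem eq_zero_of_quotientCoeff {I : Ideal (MvPolynomial (Fin 3) ℂ)} (hI : IsMonomialIdeal I)
    (q : MvPolynomial (Fin 3) ℂ ⧸ I) (hq : ∀ d, xm d ∉ I → quotientCoeff hI d q = 0) : q = 0 := by
  obtain ⟨p, rfl⟩ := Ideal.Quotient.mk_surjective q
  rw [Ideal.Quotient.eq_zero_iff_mem, mem_iff_forall_exponentCoeff hI]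
  intro d hd
  by_contra h
  exact hd (by rw [← quotientCoeff_mk hI h, hq d h])

theorem exponentCoeff_mul (d e : Exponent) (p : MvPolynomial (Fin 3) ℂ) :
    exponentCoeff d (xm e * p) = if e ≤ d then exponentCoeff (d - e) p else 0 := by
  unfold exponentCoeff xm
  rw [lcoeff_apply, coeff_monomial_mul']
  simp only [toFinsupp_le, one_mul, lcoeff_apply, toFinsupp_sub]

theorem quotientCoeff_smul {I : Ideal (MvPolynomial (Fin 3) ℂ)} (hI : IsMonomialIdeal I)
    {d : Exponent} (hd : xm d ∉ I) (e : Exponent) (q : MvPolynomial (Fin 3) ℂ ⧸ I) :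
    quotientCoeff hI d (xm e • q) = if e ≤ d then quotientCoeff hI (d - e) q else 0 := by
  obtain ⟨p, rfl⟩ := Ideal.Quotient.mk_surjective q
  have h : xm e • Ideal.Quotient.mk I p = Ideal.Quotient.mk I (xm e * p) := rfl
  rw [h, quotientCoeff_mk hI hd, exponentCoeff_mul]
  split_ifs with hed
  · rw [quotientCoeff_mk]
    intro hmem
    refine hd ?_
    have := I.mul_mem_left (xm e) hmem
    rwa [xm_mul, add_tsub_cancel_of_le hed] at this
  · rfl

/-- The colength of a monomial ideal counts the monomials outside. -/
theorem finrank_quotient {I : Ideal (MvPolynomial (Fin 3) ℂ)} (hI : IsMonomialIdeal I) :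
    Module.finrank ℂ (MvPolynomial (Fin 3) ℂ ⧸ I) = {d | xm d ∉ I}.ncard := by
  classical
  let v : {d | xm d ∉ I} → MvPolynomial (Fin 3) ℂ ⧸ I := fun d => Ideal.Quotient.mk I (xm d)
  have hv : LinearIndependent ℂ v := by
    rw [linearIndependent_iff']
    intro s c hc i hi
    have h := congrArg (quotientCoeff hI i.1) hc
    simp only [map_sum, map_smul, map_zero, v, quotientCoeff_mk hI i.2, exponentCoeff_xm] at h
    simpa [Subtype.ext_iff, Finset.sum_ite_eq', ← Subtype.ext_iff, hi] using h
  have hs : ⊤ ≤ Submodule.span ℂ (Set.range v) := by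
    rintro q -
    obtain ⟨p, rfl⟩ := Ideal.Quotient.mk_surjective q
    have hp : p ∈ Submodule.span ℂ (Set.range xm) := by rw [span_xm]; trivial
    induction hp using Submodule.span_induction with
    | mem x hx =>
      obtain ⟨d, rfl⟩ := hx
      by_cases hd : xm d ∈ I
      · rw [Ideal.Quotient.eq_zero_iff_mem.2 hd]
        exact Submodule.zero_mem _
      · exact Submodule.subset_span ⟨⟨d, hd⟩, rfl⟩
    | zero => rw [map_zero]; exact Submodule.zero_mem _
    | add x y _ _ hx hy => rw [map_add]; exact Submodule.add_mem _ hx hy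
    | smul a x _ hx => exact Submodule.smul_mem _ a hx
  rw [Module.finrank_eq_nat_card_basis (Module.Basis.mk hv hs)]
  rfl

/-- Monomial ideals described by their staircase. -/
def IsStaircase (I : Ideal (MvPolynomial (Fin 3) ℂ)) (h : ℕ → ℕ → ℕ) : Prop :=
  ∀ d, xm d ∉ I ↔ isStd h d = true

/-- The coefficient of `s` in the image of `g`. -/
noncomputable def homCoeff {I : Ideal (MvPolynomial (Fin 3) ℂ)} (hI : IsMonomialIdeal I)
    {g : Exponent} (hg : xm g ∈ I) (s : Exponent) :
    (I →ₗ[MvPolynomial (Fin 3) ℂ] (MvPolynomial (Fin 3) ℂ ⧸ I)) →ₗ[ℂ] ℂ where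
  toFun φ := quotientCoeff hI s (φ ⟨xm g, hg⟩)
  map_add' φ ψ := by simp
  map_smul' a φ := by simp

theorem homCoeff_syzygy {I : Ideal (MvPolynomial (Fin 3) ℂ)} (hI : IsMonomialIdeal I)
    {g q : Exponent} (hg : xm g ∈ I) (hq : xm q ∈ I) {s : Exponent}
    (hs : xm (s + (q - g)) ∉ I) (φ : I →ₗ[MvPolynomial (Fin 3) ℂ] (MvPolynomial (Fin 3) ℂ ⧸ I)) :
    homCoeff hI hg s φ = if g - q ≤ s + (q - g) then homCoeff hI hq (s + (q - g) - (g - q)) φ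
      else 0 := by
  have h : xm (q - g) • φ ⟨xm g, hg⟩ = xm (g - q) • φ ⟨xm q, hq⟩ := by
    rw [← map_smul, ← map_smul]
    congr 1
    ext1
    change xm (q - g) * xm g = xm (g - q) * xm q
    rw [xm_mul, xm_mul]
    congr 1
    simp only [Prod.ext_iff, Prod.fst_add, Prod.snd_add, Prod.fst_sub, Prod.snd_sub]
    omega
  have h' := congrArg (quotientCoeff hI (s + (q - g))) h
  rw [quotientCoeff_smul hI hs, quotientCoeff_smul hI hs, if_pos le_add_self,
    add_tsub_cancel_right] at h'
  exact h'

theorem mem_of_le {I : Ideal (MvPolynomial (Fin 3) ℂ)} {d e : Exponent} (hde : d ≤ e)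
    (hd : xm d ∈ I) : xm e ∈ I := by
  have := I.mul_mem_left (xm (e - d)) hd
  rwa [xm_mul, tsub_add_cancel_of_le hde] at this

theorem mem_stdList {h : ℕ → ℕ → ℕ} (hh : ∀ i j, 3 ≤ i ∨ 4 ≤ j → h i j = 0) (d : Exponent) :
    d ∈ stdList h ↔ isStd h d = true := by
  obtain ⟨i, j, k⟩ := d
  simp only [stdList, List.mem_flatMap, List.mem_range, List.mem_map, Prod.mk.injEq, isStd,
    Nat.blt_eq]
  constructor
  · rintro ⟨i, _, j, _, k, hk, rfl, rfl, rfl⟩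
    exact hk
  · intro hk
    have := hh i j
    exact ⟨i, by omega, j, by omega, k, hk, rfl, rfl, rfl⟩

theorem not_isStd_of_mem_genList {h : ℕ → ℕ → ℕ} {g : Exponent} (hg : g ∈ genList h) :
    ¬ isStd h g = true := by
  simp only [genList, List.mem_flatMap, List.mem_range] at hg
  obtain ⟨i, _, j, _, hg⟩ := hg
  split_ifs at hg
  · rw [List.mem_singleton.1 hg]
    simp [isStd]
  · simp at hg

theorem exists_mem_genList_le {h : ℕ → ℕ → ℕ} (hh : ∀ i j, 3 ≤ i ∨ 4 ≤ j → h i j = 0)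
    (i j k : ℕ) (hk : h i j ≤ k) : ∃ g ∈ genList h, g ≤ (i, j, k) := by
  induction hn : i + j + k using Nat.strong_induction_on generalizing i j k with
  | _ n ih =>
    by_cases h1 : h i j < k
    · obtain ⟨g, hg, hle⟩ := ih (i + j + (k - 1)) (by omega) i j (k - 1) (by omega) rfl
      exact ⟨g, hg, hle.trans ⟨le_rfl, le_rfl, Nat.sub_le _ _⟩⟩
    by_cases h2 : 0 < i ∧ h (i - 1) j ≤ k
    · obtain ⟨g, hg, hle⟩ := ih (i - 1 + j + k) (by omega) (i - 1) j k h2.2 rfl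
      exact ⟨g, hg, hle.trans ⟨Nat.sub_le _ _, le_rfl, le_rfl⟩⟩
    by_cases h3 : 0 < j ∧ h i (j - 1) ≤ k
    · obtain ⟨g, hg, hle⟩ := ih (i + (j - 1) + k) (by omega) i (j - 1) k h3.2 rfl
      exact ⟨g, hg, hle.trans ⟨le_rfl, Nat.sub_le _ _, le_rfl⟩⟩
    have hi := hh (i - 1) j
    have hj := hh i (j - 1)
    obtain rfl : k = h i j := by omega
    refine ⟨(i, j, h i j), ?_, le_rfl⟩
    simp only [genList, List.mem_flatMap, List.mem_range]
    refine ⟨i, by omega, j, by omega, ?_⟩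
    rw [if_pos]
    · simp
    · simp only [Bool.and_eq_true, Bool.or_eq_true, Nat.beq_eq, Nat.blt_eq]
      omega

theorem fst_mem_of_mem_freePairs {h : ℕ → ℕ → ℕ} {S gs earlier : List Exponent}
    {p : Exponent × Exponent} (hp : p ∈ freePairs h S earlier gs) : p.1 ∈ gs := by
  induction gs generalizing earlier with
  | nil => simp [freePairs] at hp
  | cons g gs ih =>
    rw [freePairs, List.mem_append, List.mem_map] at hp
    rcases hp with ⟨s, _, rfl⟩ | hp
    · simp
    · exact List.mem_cons_of_mem _ (ih hp)

theorem xm_mem_of_mem_coordinates {I : Ideal (MvPolynomial (Fin 3) ℂ)} {h : ℕ → ℕ → ℕ}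
    (hIh : IsStaircase I h) {p : Exponent × Exponent} (hp : p ∈ coordinates h) : xm p.1 ∈ I := by
  by_contra hmem
  exact not_isStd_of_mem_genList (fst_mem_of_mem_freePairs hp) ((hIh _).1 hmem)

theorem homCoeff_eq_zero_of_freePairs {I : Ideal (MvPolynomial (Fin 3) ℂ)}
    (hI : IsMonomialIdeal I) {h : ℕ → ℕ → ℕ} (hIh : IsStaircase I h) {S : List Exponent}
    (hS : ∀ d, d ∈ S ↔ isStd h d = true)
    (φ : I →ₗ[MvPolynomial (Fin 3) ℂ] (MvPolynomial (Fin 3) ℂ ⧸ I))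
    (gs earlier : List Exponent) (hgs : ∀ g ∈ gs, xm g ∈ I)
    (hearlier : ∀ q ∈ earlier, ∃ hq : xm q ∈ I, ∀ s, xm s ∉ I → homCoeff hI hq s φ = 0)
    (hφ : ∀ p ∈ freePairs h S earlier gs, ∀ hp : xm p.1 ∈ I, homCoeff hI hp p.2 φ = 0) :
    ∀ g ∈ gs, ∃ hg : xm g ∈ I, ∀ s, xm s ∉ I → homCoeff hI hg s φ = 0 := by
  induction gs generalizing earlier with
  | nil => simp
  | cons g gs ih =>
    have hg : xm g ∈ I := hgs g (by simp)
    have key : ∀ s, xm s ∉ I → homCoeff hI hg s φ = 0 := by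
      intro s hs
      by_cases hfree : isFree h earlier gs g s = true
      · refine hφ (g, s) ?_ hg
        rw [freePairs, List.mem_append, List.mem_map]
        exact Or.inl ⟨s, List.mem_filter.2 ⟨(hS s).2 ((hIh s).1 hs), hfree⟩, rfl⟩
      · simp only [isFree, Bool.and_eq_true, List.all_eq_true, Bool.not_eq_true',
          Bool.or_eq_true, divides_iff, not_and_or, not_forall, not_or, Bool.not_eq_false] at hfree
        rcases hfree with ⟨q, hq, hstd⟩ | ⟨q, hq, hstd, hle⟩
        · obtain ⟨hqI, hq0⟩ := hearlier q hq
          rw [homCoeff_syzygy hI hg hqI ((hIh _).2 hstd)]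
          split_ifs with hle
          · exact hq0 _ fun hmem => (hIh _).2 hstd (mem_of_le tsub_le_self hmem)
          · rfl
        · rw [homCoeff_syzygy hI hg (hgs q (by simp [hq])) ((hIh _).2 hstd), if_neg]
          contrapose! hle
          simp only [Prod.le_def, Prod.fst_add, Prod.snd_add, Prod.fst_sub, Prod.snd_sub]
            at hle ⊢
          omega
    intro q hq
    rcases List.mem_cons.1 hq with rfl | hq
    · exact ⟨hg, key⟩
    · refine ih (g :: earlier) (fun q hq => hgs q (by simp [hq])) ?_ ?_ q hq
      · intro q hq
        rcases List.mem_cons.1 hq with rfl | hq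
        · exact ⟨hg, key⟩
        · exact hearlier q hq
      · intro p hp
        refine hφ p ?_
        rw [freePairs, List.mem_append]
        exact Or.inr hp

theorem hom_eq_zero_of_coordinates {I : Ideal (MvPolynomial (Fin 3) ℂ)}
    (hI : IsMonomialIdeal I) {h : ℕ → ℕ → ℕ} (hh : ∀ i j, 3 ≤ i ∨ 4 ≤ j → h i j = 0)
    (hIh : IsStaircase I h) (φ : I →ₗ[MvPolynomial (Fin 3) ℂ] (MvPolynomial (Fin 3) ℂ ⧸ I))
    (hφ : ∀ p ∈ coordinates h, ∀ hp : xm p.1 ∈ I, homCoeff hI hp p.2 φ = 0) : φ = 0 := by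
  have hgen := homCoeff_eq_zero_of_freePairs hI hIh (mem_stdList hh) φ (genList h) []
    (fun g hg => by
      by_contra hmem
      exact not_isStd_of_mem_genList hg ((hIh g).1 hmem)) (by simp) hφ
  have hxm : ∀ p ∈ Submodule.span ℂ (xm '' {d | xm d ∈ I}), ∃ hp : p ∈ I, φ ⟨p, hp⟩ = 0 := by
    intro p hp
    induction hp using Submodule.span_induction with
    | mem x hx =>
      obtain ⟨⟨i, j, k⟩, hd, rfl⟩ := hx
      refine ⟨hd, ?_⟩
      have hk : h i j ≤ k := by
        by_contra hlt
        exact (hIh (i, j, k)).2 (by simpa [isStd] using hlt) hd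
      obtain ⟨g, hg, hle⟩ := exists_mem_genList_le hh i j k hk
      obtain ⟨hgI, hg0⟩ := hgen g hg
      have hmul : (⟨xm (i, j, k), hd⟩ : I) = xm ((i, j, k) - g) • (⟨xm g, hgI⟩ : I) := by
        ext1
        change _ = xm ((i, j, k) - g) * xm g
        rw [xm_mul, tsub_add_cancel_of_le hle]
      rw [hmul, map_smul, eq_zero_of_quotientCoeff hI (φ ⟨xm g, hgI⟩) hg0, smul_zero]
    | zero => exact ⟨I.zero_mem, map_zero φ⟩
    | add x y _ _ hx hy =>
      obtain ⟨hx, hx0⟩ := hx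
      obtain ⟨hy, hy0⟩ := hy
      refine ⟨I.add_mem hx hy, ?_⟩
      have := map_add φ ⟨x, hx⟩ ⟨y, hy⟩
      rwa [hx0, hy0, add_zero] at this
    | smul a x _ hx =>
      obtain ⟨hx, hx0⟩ := hx
      refine ⟨(I.restrictScalars ℂ).smul_mem a hx, ?_⟩
      have := map_smul (φ.restrictScalars ℂ) a ⟨x, hx⟩
      rw [LinearMap.restrictScalars_apply, LinearMap.restrictScalars_apply, hx0, smul_zero] at this
      exact this
  ext ⟨p, hp⟩
  exact (hxm p (mem_span_xm hI hp)).2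

/-- Evaluation of homomorphisms at the coordinates. -/
noncomputable def coordinateMap {I : Ideal (MvPolynomial (Fin 3) ℂ)}
    (hI : IsMonomialIdeal I) {h : ℕ → ℕ → ℕ} (hIh : IsStaircase I h) :
    (I →ₗ[MvPolynomial (Fin 3) ℂ] (MvPolynomial (Fin 3) ℂ ⧸ I)) →ₗ[ℂ]
      (Fin (coordinates h).length → ℂ) :=
  LinearMap.pi fun i => homCoeff hI
    (xm_mem_of_mem_coordinates hIh ((coordinates h).get_mem i)) ((coordinates h).get i).2

theorem coordinateMap_injective {I : Ideal (MvPolynomial (Fin 3) ℂ)}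
    (hI : IsMonomialIdeal I) {h : ℕ → ℕ → ℕ} (hh : ∀ i j, 3 ≤ i ∨ 4 ≤ j → h i j = 0)
    (hIh : IsStaircase I h) : Function.Injective (coordinateMap hI hIh) := by
  rw [← LinearMap.ker_eq_bot, LinearMap.ker_eq_bot']
  intro φ hφ
  refine hom_eq_zero_of_coordinates hI hh hIh φ fun p hp _ => ?_
  obtain ⟨i, rfl⟩ := List.get_of_mem hp
  exact congrFun hφ i

theorem tangentDim_le {I : Ideal (MvPolynomial (Fin 3) ℂ)}
    (hI : IsMonomialIdeal I) {h : ℕ → ℕ → ℕ} (hh : ∀ i j, 3 ≤ i ∨ 4 ≤ j → h i j = 0)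
    (hIh : IsStaircase I h) : tangentDim I ≤ (coordinates h).length := by
  have := LinearMap.finrank_le_finrank_of_injective (coordinateMap_injective hI hh hIh)
  rwa [Module.finrank_fintype_fun_eq_card, Fintype.card_fin] at this

/-- A function on the monomials of a monomial ideal that is compatible with multiplication by the
variables extends to a homomorphism. -/
theorem exists_hom_of_monomials {I : Ideal (MvPolynomial (Fin 3) ℂ)} (hI : IsMonomialIdeal I)
    (τ : Exponent → MvPolynomial (Fin 3) ℂ ⧸ I)
    (hτ : ∀ m, xm m ∈ I → ∀ e ∈ unitExponents, τ (m + e) = xm e • τ m) :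
    ∃ φ : I →ₗ[MvPolynomial (Fin 3) ℂ] (MvPolynomial (Fin 3) ℂ ⧸ I),
      ∀ m (hm : xm m ∈ I), φ ⟨xm m, hm⟩ = τ m := by
  have hstep : ∀ n : ℕ, ∀ e : Exponent, e.1 + e.2.1 + e.2.2 = n → ∀ m, xm m ∈ I →
      τ (m + e) = xm e • τ m := by
    intro n
    induction n with
    | zero =>
      rintro ⟨a, b, c⟩ habc m _
      obtain ⟨rfl, rfl, rfl⟩ : a = 0 ∧ b = 0 ∧ c = 0 := by simp only at habc; omega
      have : xm (0, 0, 0) = 1 := by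
        rw [← show ((0 : Fin 3 →₀ ℕ) 0, (0 : Fin 3 →₀ ℕ) 1, (0 : Fin 3 →₀ ℕ) 2) = (0, 0, 0)
          from rfl,
          ← monomial_eq_xm]
        rfl
      rw [this, one_smul]
      rfl
    | succ n ih =>
      intro e he m hm
      obtain ⟨u, hu, hue, hn⟩ : ∃ u ∈ unitExponents, u ≤ e ∧
          (e - u).1 + (e - u).2.1 + (e - u).2.2 = n := by
        obtain ⟨a, b, c⟩ := e
        simp only [unitExponents, List.mem_cons, List.not_mem_nil, or_false, exists_eq_or_imp,
          exists_eq_left, Prod.le_def, Prod.fst_sub, Prod.snd_sub] at he ⊢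
        omega
      rw [← tsub_add_cancel_of_le hue, ← add_assoc, hτ _ (mem_of_le le_self_add hm) u hu,
        ih _ hn m hm, ← mul_smul, xm_mul, add_comm u]
  let ψ : MvPolynomial (Fin 3) ℂ →ₗ[ℂ] (MvPolynomial (Fin 3) ℂ ⧸ I) :=
    (basisMonomials (Fin 3) ℂ).constr ℂ fun d => τ (d 0, d 1, d 2)
  have hψ : ∀ d, ψ (xm d) = τ d := by
    intro d
    exact (basisMonomials (Fin 3) ℂ).constr_basis ℂ _ (toFinsupp d)
  have hmul : ∀ r p, p ∈ I → ψ (r * p) = r • ψ p := by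
    intro r p hpI
    have hp := mem_span_xm hI hpI
    clear hpI
    have hr : r ∈ Submodule.span ℂ (Set.range xm) := by rw [span_xm]; trivial
    induction hp using Submodule.span_induction with
    | mem x hx =>
      obtain ⟨m, hm, rfl⟩ := hx
      induction hr using Submodule.span_induction with
      | mem x hx =>
        obtain ⟨e, rfl⟩ := hx
        rw [xm_mul, hψ, hψ, add_comm, hstep _ e rfl m hm]
      | zero => rw [zero_mul, map_zero, zero_smul]
      | add x y _ _ hx hy => rw [add_mul, map_add, add_smul, hx, hy]
      | smul a x _ hx => rw [smul_mul_assoc, map_smul, smul_assoc, hx]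
    | zero => rw [mul_zero, map_zero, smul_zero]
    | add x y _ _ hx hy => rw [mul_add, map_add, map_add, smul_add, hx, hy]
    | smul a x _ hx => rw [mul_smul_comm, map_smul, map_smul, smul_comm, hx]
  exact ⟨{ toFun := fun p => ψ (p : MvPolynomial (Fin 3) ℂ)
           map_add' := fun p q => ψ.map_add p q
           map_smul' := fun r p => hmul r p p.2 }, fun m _ => hψ m⟩

/-- The homomorphism translating the monomials in one bounded component. -/
theorem exists_hom_of_isComponent {I : Ideal (MvPolynomial (Fin 3) ℂ)} (hI : IsMonomialIdeal I)
    {h : ℕ → ℕ → ℕ} (hIh : IsStaircase I h) {g s : Exponent} {C : List Exponent}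
    (hC : isComponent h g s C = true) :
    ∃ φ : I →ₗ[MvPolynomial (Fin 3) ℂ] (MvPolynomial (Fin 3) ℂ ⧸ I),
      (∀ hg : xm g ∈ I, homCoeff hI hg s φ = 1) ∧
      ∀ g' s', xm s' ∉ I → ¬ (g' + s = s' + g ∧ s' ∈ C) → ∀ hg : xm g' ∈ I,
        homCoeff hI hg s' φ = 0 := by
  simp only [isComponent, Bool.and_eq_true, List.all_eq_true, Bool.or_eq_true, divides_iff,
    List.contains_iff_mem, Bool.not_eq_true'] at hC
  obtain ⟨-, hsC, hC⟩ := hC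
  obtain ⟨φ, hφ⟩ := exists_hom_of_monomials hI
    (fun m => if g ≤ m + s ∧ m + s - g ∈ C then Ideal.Quotient.mk I (xm (m + s - g)) else 0) (by
      intro m hm e he
      by_cases h1 : g ≤ m + s ∧ m + s - g ∈ C
      · rw [if_pos h1]
        have hle : g ≤ m + e + s := h1.1.trans (by rw [add_right_comm]; exact le_self_add)
        have heq : m + e + s - g = m + s - g + e := by
          rw [add_right_comm, tsub_add_eq_add_tsub h1.1]
        have hsmul : xm e • Ideal.Quotient.mk I (xm (m + s - g)) =
            Ideal.Quotient.mk I (xm (m + s - g + e)) := by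
          rw [add_comm (m + s - g), ← xm_mul]
          rfl
        rw [heq, hsmul]
        rcases ((hC _ h1.2).2.2 e he).1 with hstd | hmem
        · rw [Ideal.Quotient.eq_zero_iff_mem.2, ite_self]
          by_contra hne
          rw [(hIh _).1 hne] at hstd
          exact absurd hstd (by simp)
        · rw [if_pos ⟨hle, hmem⟩]
      · rw [if_neg h1, smul_zero, if_neg]
        rintro ⟨hle, hmem⟩
        have heq : m + e + s - g + g - s = m + e := by
          rw [tsub_add_cancel_of_le hle, add_tsub_cancel_right]
        have hm' : ¬ isStd h m = true := fun hstd => (hIh m).2 hstd hm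
        have h2 := ((hC _ hmem).2.2 e he).2
        rw [heq, add_tsub_cancel_right] at h2
        rcases h2 with (hle' | hstd) | ⟨hle', hmem'⟩
        · rw [← Bool.not_eq_true, divides_iff] at hle'
          exact hle' le_add_self
        · exact hm' hstd
        · refine h1 ⟨?_, ?_⟩
          · simp only [Prod.le_def, Prod.fst_add, Prod.snd_add, Prod.fst_sub, Prod.snd_sub]
              at hle hle' ⊢
            omega
          · convert hmem' using 1
            simp only [Prod.le_def, Prod.ext_iff, Prod.fst_add, Prod.snd_add, Prod.fst_sub,
              Prod.snd_sub] at hle hle' ⊢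
            omega)
  refine ⟨φ, fun hg => ?_, fun g' s' hs' hne hg => ?_⟩
  · have hs := (hIh s).2 (hC s hsC).1
    change quotientCoeff hI s (φ ⟨xm g, hg⟩) = 1
    rw [hφ, add_tsub_cancel_left, if_pos ⟨le_self_add, hsC⟩, quotientCoeff_mk hI hs,
      exponentCoeff_xm, if_pos rfl]
  · change quotientCoeff hI s' (φ ⟨xm g', hg⟩) = 0
    rw [hφ]
    split_ifs with h1
    · rw [quotientCoeff_mk hI hs', exponentCoeff_xm, if_neg]
      rintro rfl
      exact hne ⟨(tsub_add_cancel_of_le h1.1).symm, h1.2⟩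
    · exact map_zero _

theorem snd_mem_of_mem_freePairs {h : ℕ → ℕ → ℕ} {S gs earlier : List Exponent}
    {p : Exponent × Exponent} (hp : p ∈ freePairs h S earlier gs) : p.2 ∈ S := by
  induction gs generalizing earlier with
  | nil => simp [freePairs] at hp
  | cons g gs ih =>
    rw [freePairs, List.mem_append, List.mem_map] at hp
    rcases hp with ⟨s, hs, rfl⟩ | hp
    · exact (List.mem_filter.1 hs).1
    · exact ih hp

theorem le_tangentDim {I : Ideal (MvPolynomial (Fin 3) ℂ)}
    (hI : IsMonomialIdeal I) {h : ℕ → ℕ → ℕ} (hh : ∀ i j, 3 ≤ i ∨ 4 ≤ j → h i j = 0)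
    (hIh : IsStaircase I h) (hcheck : independentCheck h = true) :
    (coordinates h).length ≤ tangentDim I := by
  simp only [independentCheck, Bool.and_eq_true, List.all_eq_true, decide_eq_true_eq,
    Bool.not_eq_true'] at hcheck
  obtain ⟨hcomp, hpair⟩ := hcheck
  let L := coordinates h
  have hex := fun i : Fin L.length => exists_hom_of_isComponent hI hIh (hcomp _ (L.get_mem i))
  choose φ hφ1 hφ0 using hex
  have : Module.Finite ℂ (I →ₗ[MvPolynomial (Fin 3) ℂ] (MvPolynomial (Fin 3) ℂ ⧸ I)) :=
    Module.Finite.of_injective _ (coordinateMap_injective hI hh hIh)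
  have hval : ∀ i j, coordinateMap hI hIh (φ i) j = if i = j then 1 else 0 := by
    intro i j
    have hj : xm (L.get j).1 ∈ I := xm_mem_of_mem_coordinates hIh (L.get_mem j)
    change homCoeff hI hj (L.get j).2 (φ i) = _
    split_ifs with hij
    · subst hij
      exact hφ1 i hj
    · refine hφ0 i _ _ ?_ ?_ hj
      · exact (hIh _).2 ((mem_stdList hh _).1 (snd_mem_of_mem_freePairs (L.get_mem j)))
      · have hmeets : meets h (L.get j) (L.get i) = false := by
          rcases lt_or_gt_of_ne hij with hlt | hlt
          · exact (List.pairwise_iff_get.1 hpair i j hlt).2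
          · exact (List.pairwise_iff_get.1 hpair j i hlt).1
        rw [← Bool.not_eq_true] at hmeets
        simpa only [meets, Bool.and_eq_true, decide_eq_true_eq, List.contains_iff_mem]
          using hmeets
  have hli : LinearIndependent ℂ φ := by
    refine LinearIndependent.of_comp (coordinateMap hI hIh) ?_
    convert (Pi.basisFun ℂ (Fin L.length)).linearIndependent using 1
    ext i j
    rw [Function.comp_apply, hval, Pi.basisFun_apply, Pi.single_apply]
    simp only [eq_comm]
  have hcard := hli.fintype_card_le_finrank
  rwa [Fintype.card_fin] at hcard

theorem xm_mem_of_isBorelFixed {I : Ideal (MvPolynomial (Fin 3) ℂ)} (hB : IsBorelFixed I)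
    {i j k : ℕ} : (xm (i, j + 1, k) ∈ I → xm (i + 1, j, k) ∈ I) ∧
      (xm (i, j, k + 1) ∈ I → xm (i, j + 1, k) ∈ I) := by
  refine ⟨fun hm => ?_, fun hm => ?_⟩
  · have key : toFinsupp (i, j + 1, k) + Finsupp.single 0 1 - Finsupp.single 1 1
        = toFinsupp (i + 1, j, k) := by
      ext a
      fin_cases a <;> simp [toFinsupp, Matrix.vecHead, Matrix.vecTail]
    rw [xm, ← key]
    exact hB _ hm 0 1 (by decide) (Nat.succ_pos j)
  · have key : toFinsupp (i, j, k + 1) + Finsupp.single 1 1 - Finsupp.single 2 1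
        = toFinsupp (i, j + 1, k) := by
      ext a
      fin_cases a <;> simp [toFinsupp, Matrix.vecHead, Matrix.vecTail]
    rw [xm, ← key]
    exact hB _ hm 1 2 (by decide) (Nat.succ_pos k)

theorem X_zero_pow_eq_xm (n : ℕ) : (X 0 : MvPolynomial (Fin 3) ℂ) ^ n = xm (n, 0, 0) := by
  rw [X_pow_eq_monomial, monomial_eq_xm]
  simp

/-- The column heights of a strongly stable ideal of finite colength. -/
theorem exists_columnHeights {I : Ideal (MvPolynomial (Fin 3) ℂ)}
    (hfin : {d | xm d ∉ I}.Finite) : ∃ h : ℕ → ℕ → ℕ, ∀ i j k, xm (i, j, k) ∉ I ↔ k < h i j := by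
  classical
  have hex : ∀ i j, ∃ k, xm (i, j, k) ∈ I := by
    intro i j
    by_contra! hne
    exact Set.infinite_of_injective_forall_mem (f := fun k : ℕ => ((i, j, k) : Exponent))
      (fun k l hkl => by simpa using hkl) hne hfin
  refine ⟨fun i j => Nat.find (hex i j), fun i j k => ⟨fun hk => ?_, fun hk => ?_⟩⟩
  · by_contra! hle
    exact hk (mem_of_le (d := (i, j, Nat.find (hex i j))) ⟨le_rfl, le_rfl, hle⟩
      (Nat.find_spec (hex i j)))
  · exact Nat.find_min (hex i j) hk

theorem sum_columnHeights_le {A : Set Exponent} (hA : A.Finite) {h : ℕ → ℕ → ℕ}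
    (hAh : ∀ i j k, (i, j, k) ∈ A ↔ k < h i j) :
    (∑ i ∈ Finset.range 3, ∑ j ∈ Finset.range 5, h i j) ≤ A.ncard ∧
      ((∀ i j, 3 ≤ i ∨ 5 ≤ j → h i j = 0) →
        (∑ i ∈ Finset.range 3, ∑ j ∈ Finset.range 5, h i j) = A.ncard) := by
  let F : Finset Exponent := (Finset.range 3).biUnion fun i => (Finset.range 5).biUnion fun j =>
    (Finset.range (h i j)).image fun k => (i, j, k)
  have hF : ∀ i j k, (i, j, k) ∈ F ↔ i < 3 ∧ j < 5 ∧ k < h i j := by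
    intro i j k
    simp only [F, Finset.mem_biUnion, Finset.mem_range, Finset.mem_image, Prod.mk.injEq]
    constructor
    · rintro ⟨i, hi, j, hj, k, hk, rfl, rfl, rfl⟩
      exact ⟨hi, hj, hk⟩
    · rintro ⟨hi, hj, hk⟩
      exact ⟨i, hi, j, hj, k, hk, rfl, rfl, rfl⟩
  have hcard : F.card = ∑ i ∈ Finset.range 3, ∑ j ∈ Finset.range 5, h i j := by
    rw [Finset.card_biUnion]
    · refine Finset.sum_congr rfl fun i _ => ?_
      rw [Finset.card_biUnion]
      · refine Finset.sum_congr rfl fun j _ => ?_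
        rw [Finset.card_image_of_injective _ (fun k l hkl => by simpa using hkl),
          Finset.card_range]
      · intro j _ j' _ hj
        rw [Function.onFun, Finset.disjoint_left]
        rintro ⟨a, b, c⟩ h1 h2
        simp only [Finset.mem_image, Prod.mk.injEq] at h1 h2
        obtain ⟨_, _, _, rfl, _⟩ := h1
        obtain ⟨_, _, _, rfl, _⟩ := h2
        exact hj rfl
    · intro i _ i' _ hi
      rw [Function.onFun, Finset.disjoint_left]
      rintro ⟨a, b, c⟩ h1 h2
      simp only [Finset.mem_biUnion, Finset.mem_image, Prod.mk.injEq] at h1 h2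
      obtain ⟨_, _, _, _, rfl, _⟩ := h1
      obtain ⟨_, _, _, _, rfl, _⟩ := h2
      exact hi rfl
  rw [← hcard, ← Set.ncard_coe_finset]
  refine ⟨Set.ncard_le_ncard ?_ hA, fun h0 => congrArg Set.ncard (Set.ext ?_)⟩
  · rintro ⟨i, j, k⟩ hd
    exact (hAh i j k).2 ((hF i j k).1 hd).2.2
  · rintro ⟨i, j, k⟩
    have := h0 i j
    rw [Finset.mem_coe, hF, hAh]
    omega

theorem exists_table {I : Ideal (MvPolynomial (Fin 3) ℂ)} (hI : IsMonomialIdeal I)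
    (hB : IsBorelFixed I) (hl : Module.finrank ℂ (MvPolynomial (Fin 3) ℂ ⧸ I) = 11)
    (hx : xm (3, 0, 0) ∈ I) :
    ∃ a0 a1 a2 a3 b0 b1 b2 c0, IsStaircase I (table [[a0, a1, a2, a3], [b0, b1, b2], [c0]]) ∧
      HasBound a0 a1 a2 a3 b0 b1 b2 c0 := by
  rw [finrank_quotient hI] at hl
  have hfin : {d | xm d ∉ I}.Finite := Set.finite_of_ncard_pos (by omega)
  obtain ⟨h, hh⟩ := exists_columnHeights hfin
  have hrow : ∀ i j, h (i + 1) j ≤ h i (j + 1) := by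
    intro i j
    by_contra! hlt
    refine lt_irrefl (h i (j + 1)) ((hh _ _ _).1 fun hm => (hh _ _ _).2 hlt ?_)
    exact (xm_mem_of_isBorelFixed hB).1 hm
  have hcol : ∀ i j, h i (j + 1) = 0 ∨ h i (j + 1) < h i j := by
    intro i j
    by_contra! hne
    obtain ⟨m, hm⟩ := Nat.exists_eq_succ_of_ne_zero hne.1
    have h1 : m + 1 < h i j := (hh _ _ _).1 fun hmem =>
      (hh i (j + 1) m).2 (by omega) ((xm_mem_of_isBorelFixed hB).2 hmem)
    omega
  have hi3 : ∀ i j, 3 ≤ i → h i j = 0 := by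
    intro i j hi
    by_contra hne
    exact (hh i j 0).2 (Nat.pos_of_ne_zero hne)
      (mem_of_le ⟨hi, Nat.zero_le _, Nat.zero_le _⟩ hx)
  obtain ⟨hle, heq⟩ := sum_columnHeights_le hfin (h := h) hh
  rw [hl] at hle heq
  simp only [Finset.sum_range_succ, Finset.sum_range_zero, zero_add] at hle heq
  have r0 := hrow 0
  have r1 := hrow 1
  have c0 := hcol 0
  have c1 := hcol 1
  have c2 := hcol 2
  have r00 := r0 0; have r01 := r0 1; have r02 := r0 2; have r03 := r0 3; have r04 := r0 4
  have r10 := r1 0; have r11 := r1 1; have r12 := r1 2; have r13 := r1 3; have r14 := r1 4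
  have c00 := c0 0; have c01 := c0 1; have c02 := c0 2; have c03 := c0 3; have c04 := c0 4
  have c05 := c0 5
  have c10 := c1 0; have c11 := c1 1; have c12 := c1 2; have c13 := c1 3; have c14 := c1 4
  have c20 := c2 0; have c21 := c2 1; have c22 := c2 2; have c23 := c2 3
  clear r0 r1 c0 c1 c2
  simp only [Nat.reduceAdd, zero_add] at *
  have h04 : h 0 4 = 0 := by omega
  have h14 : h 1 4 = 0 := by omega
  have h24 : h 2 4 = 0 := by omega
  have hj4 : ∀ i j, 4 ≤ j → h i j = 0 := by
    intro i j hj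
    induction j, hj using Nat.le_induction with
    | base =>
      rcases lt_or_ge i 3 with hi | hi
      · interval_cases i <;> assumption
      · exact hi3 i 4 hi
    | succ j _ ih => have := hcol i j; omega
  specialize heq fun i j hij => hij.elim (hi3 i j) fun hj => hj4 i j (by omega)
  have h13 : h 1 3 = 0 := by omega
  have h23 : h 2 3 = 0 := by omega
  have h22 : h 2 2 = 0 := by omega
  have h21 : h 2 1 = 0 := by omega
  refine ⟨h 0 0, h 0 1, h 0 2, h 0 3, h 1 0, h 1 1, h 1 2, h 2 0, ?_, ?_⟩
  · have htable : ∀ i j, table [[h 0 0, h 0 1, h 0 2, h 0 3], [h 1 0, h 1 1, h 1 2], [h 2 0]] i j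
        = h i j := by
      intro i j
      rcases lt_or_ge i 3 with hi | hi
      · rcases lt_or_ge j 4 with hj | hj
        · interval_cases i <;> interval_cases j <;> simp [table, *]
        · rw [hj4 i j hj]
          obtain ⟨j, rfl⟩ := Nat.exists_eq_add_of_le' hj
          interval_cases i <;> simp [table]
      · rw [hi3 i j hi]
        obtain ⟨i, rfl⟩ := Nat.exists_eq_add_of_le' hi
        simp [table]
    rintro ⟨i, j, k⟩
    rw [hh, isStd, Nat.blt_eq, htable]
  · refine rowHasBound _ ?_ _ ?_ ?_ _ ?_ ?_ _ ?_ ?_ _ ?_ ?_ _ ?_ ?_ _ ?_ ?_ _ ?_ ?_ <;>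
      first
      | (rw [List.mem_range]; omega)
      | omega

theorem table_eq_zero (a0 a1 a2 a3 b0 b1 b2 c0 i j : ℕ) (hij : 3 ≤ i ∨ 4 ≤ j) :
    table [[a0, a1, a2, a3], [b0, b1, b2], [c0]] i j = 0 := by
  rcases hij with hi | hj
  · obtain ⟨i, rfl⟩ := Nat.exists_eq_add_of_le' hi
    simp [table]
  · obtain ⟨j, rfl⟩ := Nat.exists_eq_add_of_le' hj
    rcases i with _ | _ | _ | i <;> simp [table]

open Classical in
theorem tangentDim_le_of_finrank {I : Ideal (MvPolynomial (Fin 3) ℂ)} (hI : IsMonomialIdeal I)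
    (hB : IsBorelFixed I) (hl : Module.finrank ℂ (MvPolynomial (Fin 3) ℂ ⧸ I) = 11)
    (hx : xm (3, 0, 0) ∈ I) :
    tangentDim I ≤ if xm (2, 0, 0) ∈ I then if xm (1, 0, 0) ∈ I then 48 else 49 else 63 := by
  obtain ⟨a0, a1, a2, a3, b0, b1, b2, c0, hS, hbound⟩ := exists_table hI hB hl hx
  have h2 : xm (2, 0, 0) ∈ I ↔ c0 = 0 := by
    rw [← not_iff_not, hS (2, 0, 0)]
    simp [isStd, table, Nat.pos_iff_ne_zero]
  have h1 : xm (1, 0, 0) ∈ I ↔ b0 = 0 := by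
    rw [← not_iff_not, hS (1, 0, 0)]
    simp [isStd, table, Nat.pos_iff_ne_zero]
  simp only [h1, h2]
  exact (tangentDim_le hI (table_eq_zero _ _ _ _ _ _ _ _) hS).trans hbound

/-- The exchange conditions for a staircase to be strongly stable. -/
def stableCheck (h : ℕ → ℕ → ℕ) : Bool :=
  (stdList h).all fun d =>
    (Nat.beq d.1 0 || isStd h (d.1 - 1, d.2.1 + 1, d.2.2)) &&
      (Nat.beq d.2.1 0 || isStd h (d.1, d.2.1 - 1, d.2.2 + 1))

/-- Every strongly stable staircase comes from a Borel-fixed ideal. -/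
theorem exists_ideal {h : ℕ → ℕ → ℕ} (hh : ∀ i j, 3 ≤ i ∨ 4 ≤ j → h i j = 0)
    (hs : stableCheck h = true) :
    ∃ I, IsMonomialIdeal I ∧ IsBorelFixed I ∧ IsStaircase I h := by
  simp only [stableCheck, List.all_eq_true, mem_stdList hh, Bool.and_eq_true, Bool.or_eq_true,
    Nat.beq_eq] at hs
  have hx : ∀ i j k, isStd h (i + 1, j, k) = true → isStd h (i, j + 1, k) = true := by
    intro i j k hd
    simpa using (hs _ hd).1
  have hy : ∀ i j k, isStd h (i, j + 1, k) = true → isStd h (i, j, k + 1) = true := by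
    intro i j k hd
    simpa using (hs _ hd).2
  have hz : ∀ i j k, isStd h (i, j, k + 1) = true → isStd h (i, j, k) = true := by
    intro i j k hd
    simp only [isStd, Nat.blt_eq] at hd ⊢
    omega
  have hdown : ∀ n : ℕ, ∀ d f : Exponent, f.1 + f.2.1 + f.2.2 = n → isStd h (d + f) = true →
      isStd h d = true := by
    intro n
    induction n with
    | zero =>
      rintro ⟨i, j, k⟩ ⟨a, b, c⟩ habc hd
      obtain ⟨rfl, rfl, rfl⟩ : a = 0 ∧ b = 0 ∧ c = 0 := by simp only at habc; omega
      exact hd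
    | succ n ih =>
      rintro ⟨i, j, k⟩ ⟨a, b, c⟩ habc hd
      simp only at habc
      rcases a with _ | a
      · rcases b with _ | b
        · rcases c with _ | c
          · omega
          · exact ih _ (0, 0, c) (by simp only; omega) (hz _ _ _ hd)
        · exact ih _ (0, b, c) (by simp only; omega) (hz _ _ _ (hy _ _ _ hd))
      · exact ih _ (a, b, c) (by simp only; omega) (hz _ _ _ (hy _ _ _ (hx _ _ _ hd)))
  let A : Set (Fin 3 →₀ ℕ) := {d | ¬ isStd h (d 0, d 1, d 2) = true}
  let I : Ideal (MvPolynomial (Fin 3) ℂ) := Ideal.span ((fun d => monomial d (1 : ℂ)) '' A)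
  have hmem : ∀ p, p ∈ I ↔ ∀ d ∈ p.support, d ∈ A := by
    intro p
    rw [mem_ideal_span_monomial_image]
    refine forall₂_congr fun d _ => ⟨?_, fun hd => ⟨d, hd, le_rfl⟩⟩
    rintro ⟨e, he, hle⟩ hd
    refine he (hdown _ _ (d 0 - e 0, d 1 - e 1, d 2 - e 2) rfl ?_)
    convert hd using 2
    simp only [Prod.mk_add_mk, Nat.add_sub_cancel' (hle _)]
  have hmon : ∀ d, monomial d (1 : ℂ) ∈ I ↔ d ∈ A := by
    intro d
    classical
    rw [hmem, support_monomial, if_neg one_ne_zero]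
    simp
  refine ⟨I, ?_, ?_, ?_⟩
  · intro p hp d hd
    rw [hmon]
    exact (hmem p).1 hp d hd
  · intro d hd i j hij hj
    rw [hmon] at hd ⊢
    intro hstd
    refine hd ?_
    obtain ⟨n, hn⟩ := Nat.exists_eq_add_of_le' hj
    fin_cases i <;> fin_cases j <;> simp at hij hn hstd
    · rw [hn] at hstd ⊢
      exact hx _ _ _ (by simpa using hstd)
    · rw [hn] at hstd ⊢
      exact hy _ _ _ (hx _ _ _ (by simpa using hstd))
    · rw [hn] at hstd ⊢
      exact hy _ _ _ (by simpa using hstd)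
  · intro d
    rw [xm, hmon]
    exact not_not

/-- A strongly stable staircase with independent coordinates is realised by a Borel-fixed ideal
whose tangent space has at least as many dimensions as there are coordinates. -/
theorem exists_borelFixed {h : ℕ → ℕ → ℕ} (hh : ∀ i j, 3 ≤ i ∨ 4 ≤ j → h i j = 0)
    (hs : stableCheck h = true) (hc : independentCheck h = true) :
    ∃ I, IsMonomialIdeal I ∧ IsBorelFixed I ∧ IsStaircase I h ∧
      Module.finrank ℂ (MvPolynomial (Fin 3) ℂ ⧸ I) = (stdList h).toFinset.card ∧
      (coordinates h).length ≤ tangentDim I := by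
  obtain ⟨I, hI, hB, hIh⟩ := exists_ideal hh hs
  refine ⟨I, hI, hB, hIh, ?_, le_tangentDim hI hh hIh hc⟩
  rw [finrank_quotient hI, ← Set.ncard_coe_finset]
  congr 1
  ext d
  simp [mem_stdList hh, hIh d]

theorem xm_mem_of_isStd_eq_false {I : Ideal (MvPolynomial (Fin 3) ℂ)} {h : ℕ → ℕ → ℕ}
    (hIh : IsStaircase I h) {d : Exponent} (hd : isStd h d = false) : xm d ∈ I := by
  by_contra hmem
  rw [hIh, hd] at hmem
  exact Bool.false_ne_true hmem

theorem TmaxEq_eleven_two : TmaxEq 11 2 49 := by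
  have hub : ∀ I : Ideal (MvPolynomial (Fin 3) ℂ), IsMonomialIdeal I → IsBorelFixed I →
      Module.finrank ℂ (MvPolynomial (Fin 3) ℂ ⧸ I) = 11 → xm (2, 0, 0) ∈ I →
      xm (1, 0, 0) ∉ I → tangentDim I ≤ 49 := by
    intro I hI hB hl h2 h1
    simpa only [if_pos h2, if_neg h1] using
      tangentDim_le_of_finrank hI hB hl (mem_of_le (by decide) h2)
  constructor
  · obtain ⟨I, hI, hB, hIh, hl, hle⟩ := exists_borelFixed (table_eq_zero 4 3 1 0 2 1 0 0)
      (by decide +kernel) independentCheck_of_two_rows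
    rw [length_coordinates_of_two_rows] at hle
    have hl' : Module.finrank ℂ (MvPolynomial (Fin 3) ℂ ⧸ I) = 11 := hl.trans (by decide +kernel)
    have h2 : xm (2, 0, 0) ∈ I := xm_mem_of_isStd_eq_false hIh (by decide +kernel)
    have h1 : xm (1, 0, 0) ∉ I := (hIh _).2 (by decide +kernel)
    refine ⟨I, hI, hB, hl', ?_, ?_, le_antisymm hle (hub I hI hB hl' h2 h1)⟩ <;>
      rwa [X_zero_pow_eq_xm]
  · rintro _ ⟨I, hI, hB, hl, h2, h1, rfl⟩
    rw [X_zero_pow_eq_xm] at h1 h2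
    exact hub I hI hB hl h2 h1

theorem TmaxEq_eleven_three : TmaxEq 11 3 63 := by
  have hub : ∀ I : Ideal (MvPolynomial (Fin 3) ℂ), IsMonomialIdeal I → IsBorelFixed I →
      Module.finrank ℂ (MvPolynomial (Fin 3) ℂ ⧸ I) = 11 → xm (3, 0, 0) ∈ I →
      xm (2, 0, 0) ∉ I → tangentDim I ≤ 63 := by
    intro I hI hB hl h3 h2
    simpa only [if_neg h2] using tangentDim_le_of_finrank hI hB hl h3
  constructor
  · obtain ⟨I, hI, hB, hIh, hl, hle⟩ := exists_borelFixed (table_eq_zero 4 2 1 0 2 1 0 1)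
      (by decide +kernel) independentCheck_of_three_rows
    rw [length_coordinates_of_three_rows] at hle
    have hl' : Module.finrank ℂ (MvPolynomial (Fin 3) ℂ ⧸ I) = 11 := hl.trans (by decide +kernel)
    have h3 : xm (3, 0, 0) ∈ I := xm_mem_of_isStd_eq_false hIh (by decide +kernel)
    have h2 : xm (2, 0, 0) ∉ I := (hIh _).2 (by decide +kernel)
    refine ⟨I, hI, hB, hl', ?_, ?_, le_antisymm hle (hub I hI hB hl' h3 h2)⟩ <;>
      rwa [X_zero_pow_eq_xm]
  · rintro _ ⟨I, hI, hB, hl, h3, h2, rfl⟩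
    rw [X_zero_pow_eq_xm] at h2 h3
    exact hub I hI hB hl h3 h2

theorem le_of_TmaxEq_eleven_one {T : ℕ} (hT : TmaxEq 11 1 T) : T ≤ 48 := by
  obtain ⟨I, hI, hB, hl, h1, -, rfl⟩ := hT.1
  rw [X_zero_pow_eq_xm] at h1
  simpa only [if_pos h1, if_pos (mem_of_le (d := (1, 0, 0)) (e := (2, 0, 0)) (by decide) h1)] using
    tangentDim_le_of_finrank hI hB hl (mem_of_le (by decide) h1)

theorem Tmax_monotonicity_l11 :
    TmaxEq 11 2 49 ∧
    TmaxEq 11 3 63 ∧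
    (∀ T1 T2 T3 : ℕ, TmaxEq 11 1 T1 → TmaxEq 11 2 T2 → TmaxEq 11 3 T3 →
      T1 < T2 ∧ T2 < T3) := by
  refine ⟨TmaxEq_eleven_two, TmaxEq_eleven_three, fun T1 T2 T3 h1 h2 h3 => ?_⟩
  rw [h2.unique TmaxEq_eleven_two, h3.unique TmaxEq_eleven_three]
  have := le_of_TmaxEq_eleven_one h1
  omega
end
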